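/- Suppose m,n → ∞ with m/n → μ ∈ (0,∞), P^{(n)} → P weakly, and P^{(n)}_{rs} → P_{rs} ∈ (0,∞) for (r,s) = (1,0), (2,1). Then Spearman's rank correlation of the model bidegree distribution converges: ρ_Spe(f_{2,n}) → ρ_Spe(\bar f_2). -/

import Mathlib

open MeasureTheory ProbabilityTheory Filter
open scoped ENNReal Topology Classical

noncomputable section

/-- The binomial probability mass function `Bin(x,y)(s)`. -/
def binP (x : ℕ) (y : ℝ) (s : ℕ) : ℝ := (x.choose s : ℝ) * y ^ s * (1 - y) ^ (x - s)

/-- Convolution of (mass) functions on `ℕ`. -/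
def conv (f g : ℕ → ℝ) (s : ℕ) : ℝ := ∑ i ∈ Finset.range (s + 1), f i * g (s - i)

/-- Iterated convolution power: `convPow f j` is the `j`-fold convolution of `f`. -/
def convPow (f : ℕ → ℝ) : ℕ → ℕ → ℝ
  | 0 => fun s => if s = 0 then 1 else 0
  | j + 1 => conv f (convPow f j)

/-- The compound Poisson probability mass function `CPoi(lam, f)`, i.e. the law of
`H_1 + ⋯ + H_Λ` where `Λ ~ Poi(lam)` and the `H_k` are i.i.d. with mass function `f`,
independent of `Λ`. -/
def cpoi (lam : ℝ) (f : ℕ → ℝ) (s : ℕ) : ℝ :=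
  ∑' j : ℕ, Real.exp (-lam) * lam ^ j / (j.factorial : ℝ) * convPow f j s

/-- Convolution of (mass) functions on `ℕ × ℕ`. -/
def conv2 (F G : ℕ → ℕ → ℝ) (s t : ℕ) : ℝ :=
  ∑ i ∈ Finset.range (s + 1), ∑ j ∈ Finset.range (t + 1), F i j * G (s - i) (t - j)

/-- Point mass at `(1,1)`, as a mass function on `ℕ × ℕ`. -/
def delta11 (s t : ℕ) : ℝ := if s = 1 ∧ t = 1 then 1 else 0

/-- The cross moment `Q_{rs} = E[(X)_r Y^s]` of a layer type distribution `Q`,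
where `(x)_r` is the falling factorial. -/
def mom (Q : Measure (ℕ × ℝ)) (r s : ℕ) : ℝ :=
  ∫ p, (p.1.descFactorial r : ℝ) * p.2 ^ s ∂Q

/-- The increment distribution `g(s) = ∫ Bin(x-1,y)(s) x P(dx,dy) / P₁₀`. -/
def gInc (P : Measure (ℕ × ℝ)) (s : ℕ) : ℝ :=
  (∫ p, (p.1 : ℝ) * binP (p.1 - 1) p.2 s ∂P) / mom P 1 0

/-- The limiting degree distribution `\bar f_1 = CPoi(μ P₁₀, g)`. -/
def barf1 (mu : ℝ) (P : Measure (ℕ × ℝ)) (s : ℕ) : ℝ :=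
  cpoi (mu * mom P 1 0) (gInc P) s

/-- The distribution `f₂'` of `(D₁', D₂')`:
`f₂'(s,t) = ∫ Bin(x-2,y)(s) Bin(x-2,y)(t) (x)₂ y P(dx,dy) / P₂₁`. -/
def f2p (P : Measure (ℕ × ℝ)) (s t : ℕ) : ℝ :=
  (∫ p, (p.1.descFactorial 2 : ℝ) * p.2 * binP (p.1 - 2) p.2 s * binP (p.1 - 2) p.2 t ∂P) /
    mom P 2 1

/-- The limiting bidegree distribution `\bar f₂ = δ₍₁,₁₎ ∗ (\bar f₁ ⊗ \bar f₁) ∗ f₂'`. -/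
def barf2 (mu : ℝ) (P : Measure (ℕ × ℝ)) : ℕ → ℕ → ℝ :=
  conv2 (conv2 delta11 fun s t => barf1 mu P s * barf1 mu P t) (f2p P)

instance (n : ℕ) : MeasurableSpace (Finset (Fin n)) := ⊤

/-- Bernoulli distribution on `Bool` with success probability `y` (truncated into `[0,1]`). -/
def bern (y : ℝ) : Measure Bool :=
  (PMF.bernoulli (min (Real.toNNReal y) 1) (min_le_right _ _)).toMeasure

instance (y : ℝ) : IsProbabilityMeasure (bern y) :=
  PMF.toMeasure.isProbabilityMeasure _

/-- The distribution of the indicator of one potential edge `e` of a layer with node set `V`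
and strength `y`: Bernoulli(`y`) if `e` is a non-loop pair inside `V`, and surely absent
otherwise. -/
def edgeFactor (n : ℕ) (V : Finset (Fin n)) (y : ℝ) (e : Sym2 (Fin n)) : Measure Bool :=
  if ¬ e.IsDiag ∧ ∀ v ∈ e, v ∈ V then bern y else Measure.dirac false

instance (n : ℕ) (V : Finset (Fin n)) (y : ℝ) (e : Sym2 (Fin n)) :
    IsProbabilityMeasure (edgeFactor n V y e) := by
  unfold edgeFactor; split <;> infer_instance

/-- Conditionally on the node set `V` and strength `y`, each non-loop pair of nodes of `V`
is linked independently with probability `y`. -/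
def edgeMeasure (n : ℕ) (V : Finset (Fin n)) (y : ℝ) : Measure (Sym2 (Fin n) → Bool) :=
  Measure.pi fun e => edgeFactor n V y e

/-- Uniformly random subset of the `n` nodes of size `x`. -/
def vertexMeasure (n x : ℕ) : Measure (Finset (Fin n)) :=
  if h : (Finset.powersetCard x (Finset.univ : Finset (Fin n))).Nonempty then
    (PMF.uniformOfFinset _ h).toMeasure
  else Measure.dirac ∅

/-- A sampled layer: its type `(x,y)`, its node set, and its edge indicators. -/
abbrev Layer (n : ℕ) := (ℕ × ℝ) × Finset (Fin n) × (Sym2 (Fin n) → Bool)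

/-- The distribution of a single layer with type distribution `Q`: the type `(x,y)` is
sampled from `Q`; conditionally on it, the node set is a uniformly random subset of size
`x` of the `n` nodes, and each pair of nodes of the node set is linked independently with
probability `y`. -/
def layerMeasure (n : ℕ) (Q : Measure (ℕ × ℝ)) : Measure (Layer n) :=
  Q.bind fun xy =>
    (vertexMeasure n xy.1).bind fun V =>
      (edgeMeasure n V xy.2).map fun f => (xy, V, f)

instance (n x : ℕ) : IsProbabilityMeasure (vertexMeasure n x) := by
  unfold vertexMeasure; split <;> infer_instance

instance (n : ℕ) (V : Finset (Fin n)) (y : ℝ) : IsProbabilityMeasure (edgeMeasure n V y) := by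
  unfold edgeMeasure; infer_instance

theorem measure_bind_univ_le {α β : Type*} [MeasurableSpace α] [MeasurableSpace β]
    (Q : Measure α) [IsProbabilityMeasure Q] {f : α → Measure β}
    (hf : ∀ a, f a Set.univ ≤ 1) : Q.bind f Set.univ ≤ 1 := by
  rw [Measure.bind, Measure.join_apply MeasurableSet.univ]
  by_cases hmeas : AEMeasurable f Q
  · rw [lintegral_map' (Measure.measurable_coe MeasurableSet.univ).aemeasurable hmeas]
    calc ∫⁻ a, f a Set.univ ∂Q ≤ ∫⁻ _, 1 ∂Q := lintegral_mono hf
      _ = 1 := by simp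
  · rw [Measure.map_of_not_aemeasurable hmeas]; simp

instance (n : ℕ) (Q : Measure (ℕ × ℝ)) [IsProbabilityMeasure Q] :
    IsFiniteMeasure (layerMeasure n Q) := by
  refine ⟨lt_of_le_of_lt ?_ ENNReal.one_lt_top⟩
  refine measure_bind_univ_le Q fun xy => ?_
  refine measure_bind_univ_le _ fun V => ?_
  have hg : Measurable fun f : Sym2 (Fin n) → Bool => ((xy, V, f) : Layer n) :=
    measurable_const.prodMk (measurable_const.prodMk measurable_id)
  rw [Measure.map_apply hg MeasurableSet.univ]
  simp

/-- The Bernoulli random graph superposition model `G_n` with `n` nodes and `m` mutually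
independent layers, each with type distribution `Q`. -/
def modelMeasure (n m : ℕ) (Q : Measure (ℕ × ℝ)) [IsProbabilityMeasure Q] :
    Measure (Fin m → Layer n) :=
  Measure.pi fun _ => layerMeasure n Q

/-- The edge set `E(G_{n,k})` of one layer. -/
def layerEdges {n : ℕ} (L : Layer n) : Finset (Sym2 (Fin n)) :=
  Finset.univ.filter fun e => L.2.2 e = true ∧ ¬ e.IsDiag ∧ ∀ v ∈ e, v ∈ L.2.1

/-- The edge set `E(G_n) = ⋃ₖ E(G_{n,k})` of the superposition graph. -/
def graphEdges {n m : ℕ} (ω : Fin m → Layer n) : Finset (Sym2 (Fin n)) :=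
  Finset.univ.biUnion fun k => layerEdges (ω k)

/-- The degree `deg_{G_n}(i)` of the node with label `i` (labels start from `0`). -/
def deg {n m : ℕ} (ω : Fin m → Layer n) (i : ℕ) : ℕ :=
  ((graphEdges ω).filter fun e => ∃ v : Fin n, v ∈ e ∧ (v : ℕ) = i).card

/-- The event that the first two nodes (labels `0` and `1`) are adjacent in `G_n`. -/
def adjEvent (n m : ℕ) : Set (Fin m → Layer n) :=
  {ω | ∃ e ∈ graphEdges ω, (∃ v : Fin n, v ∈ e ∧ (v : ℕ) = 0) ∧ ∃ v : Fin n, v ∈ e ∧ (v : ℕ) = 1}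

/-- The model bidegree distribution
`f_{2,n}(s,t) = P(deg(1) = s, deg(2) = t ∣ {1,2} ∈ E(G_n))`. -/
def bidegree (n m : ℕ) (Q : Measure (ℕ × ℝ)) [IsProbabilityMeasure Q] (s t : ℕ) : ℝ :=
  ((modelMeasure n m Q)[|adjEvent n m] {ω | deg ω 0 = s ∧ deg ω 1 = t}).toReal

/-- Expectation of `φ(U⁽¹⁾,U⁽²⁾)` where `(U⁽¹⁾,U⁽²⁾)` has mass function `F` on `ℕ²`. -/
def pmean (F : ℕ → ℕ → ℝ) (φ : ℕ → ℕ → ℝ) : ℝ :=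
  ∑' u : ℕ × ℕ, φ u.1 u.2 * F u.1 u.2

/-- Expectation of `φ(U, Z)` where `U = (U⁽¹⁾,U⁽²⁾)` and `Z = (Z⁽¹⁾,Z⁽²⁾)` are independent,
both with mass function `F` on `ℕ²`. -/
def pmean2 (F : ℕ → ℕ → ℝ) (φ : ℕ × ℕ → ℕ × ℕ → ℝ) : ℝ :=
  ∑' u : ℕ × ℕ, ∑' z : ℕ × ℕ, φ u z * F u.1 u.2 * F z.1 z.2

/-- Kendall's rank correlation coefficient
`ρ_Ken(F) = Cor(sgn(U⁽¹⁾-Z⁽¹⁾), sgn(U⁽²⁾-Z⁽²⁾))` of a mass function `F` on `ℕ²`,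
where `(U⁽¹⁾,U⁽²⁾)` and `(Z⁽¹⁾,Z⁽²⁾)` are independent and `F`-distributed. -/
def kendall (F : ℕ → ℕ → ℝ) : ℝ :=
  (pmean2 F (fun u z => Real.sign ((u.1 : ℝ) - z.1) * Real.sign ((u.2 : ℝ) - z.2)) -
      pmean2 F (fun u z => Real.sign ((u.1 : ℝ) - z.1)) *
        pmean2 F (fun u z => Real.sign ((u.2 : ℝ) - z.2))) /
    (Real.sqrt (pmean2 F (fun u z => Real.sign ((u.1 : ℝ) - z.1) ^ 2) -
        pmean2 F (fun u z => Real.sign ((u.1 : ℝ) - z.1)) ^ 2) *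
      Real.sqrt (pmean2 F (fun u z => Real.sign ((u.2 : ℝ) - z.2) ^ 2) -
        pmean2 F (fun u z => Real.sign ((u.2 : ℝ) - z.2)) ^ 2))

/-- The mid-rank function `r_i(x) = (F(-∞,x) + F(-∞,x])/2` of a marginal mass function. -/
def midRank (f : ℕ → ℝ) (x : ℕ) : ℝ :=
  ((∑' u : ℕ, if u < x then f u else 0) + ∑' u : ℕ, if u ≤ x then f u else 0) / 2

/-- Spearman's rank correlation coefficient (mid-rank convention)
`ρ_Spe(F) = Cor(r₁(U⁽¹⁾), r₂(U⁽²⁾))` of a mass function `F` on `ℕ²`,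
where `(U⁽¹⁾,U⁽²⁾)` is `F`-distributed and `r_i` is the mid-rank of the `i`-th marginal. -/
def spearman (F : ℕ → ℕ → ℝ) : ℝ :=
  (pmean F (fun s t => midRank (fun u => ∑' v : ℕ, F u v) s *
        midRank (fun v => ∑' u : ℕ, F u v) t) -
      pmean F (fun s _ => midRank (fun u => ∑' v : ℕ, F u v) s) *
        pmean F (fun _ t => midRank (fun v => ∑' u : ℕ, F u v) t)) /
    (Real.sqrt (pmean F (fun s _ => midRank (fun u => ∑' v : ℕ, F u v) s ^ 2) -
        pmean F (fun s _ => midRank (fun u => ∑' v : ℕ, F u v) s) ^ 2) *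
      Real.sqrt (pmean F (fun _ t => midRank (fun v => ∑' u : ℕ, F u v) t ^ 2) -
        pmean F (fun _ t => midRank (fun v => ∑' u : ℕ, F u v) t) ^ 2))

/-! ### Power series and generating functions -/

theorem eq_zero_of_tsum_mul_pow_eq_zero {C : ℝ} (k : ℕ) :
    ∀ c : ℕ → ℝ, (∀ j, |c j| ≤ C) → (∀ z ∈ Set.Ioo (0 : ℝ) 1, ∑' j, c j * z ^ j = 0) →
      c k = 0 := by
  have hsum : ∀ c : ℕ → ℝ, (∀ j, |c j| ≤ C) → ∀ z ∈ Set.Ioo (0 : ℝ) 1,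
      Summable fun j => c j * z ^ j := by
    intro c hc z hz
    refine Summable.of_norm_bounded
      ((summable_geometric_of_lt_one hz.1.le hz.2).mul_left C) fun j => ?_
    rw [Real.norm_eq_abs, abs_mul, abs_of_nonneg (pow_nonneg hz.1.le j)]
    exact mul_le_mul_of_nonneg_right (hc j) (pow_nonneg hz.1.le j)
  have h0 : ∀ c : ℕ → ℝ, (∀ j, |c j| ≤ C) →
      (∀ z ∈ Set.Ioo (0 : ℝ) 1, ∑' j, c j * z ^ j = 0) → c 0 = 0 := by
    intro c hc h
    have hb : ∀ z ∈ Set.Ioo (0 : ℝ) 1, |c 0| ≤ z * (C * (1 - z)⁻¹) := by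
      intro z hz
      have h1 := h z hz
      rw [(hsum c hc z hz).tsum_eq_zero_add] at h1
      have h2 : ∑' j, c (j + 1) * z ^ (j + 1) = z * ∑' j, c (j + 1) * z ^ j := by
        rw [← tsum_mul_left]; congr 1; ext j; ring
      rw [h2] at h1
      have h3 : c 0 = -(z * ∑' j, c (j + 1) * z ^ j) := by simp at h1; linarith
      rw [h3, abs_neg, abs_mul, abs_of_pos hz.1]
      refine mul_le_mul_of_nonneg_left ?_ hz.1.le
      have h4 : HasSum (fun j => C * z ^ j) (C * (1 - z)⁻¹) :=
        (hasSum_geometric_of_lt_one hz.1.le hz.2).mul_left C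
      rw [← Real.norm_eq_abs]
      refine tsum_of_norm_bounded h4 fun j => ?_
      rw [Real.norm_eq_abs, abs_mul, abs_of_nonneg (pow_nonneg hz.1.le j)]
      exact mul_le_mul_of_nonneg_right (hc _) (pow_nonneg hz.1.le j)
    have ht : Tendsto (fun z : ℝ => z * (C * (1 - z)⁻¹)) (𝓝[>] 0) (𝓝 0) := by
      have : ContinuousAt (fun z : ℝ => z * (C * (1 - z)⁻¹)) 0 := by
        refine continuousAt_id.mul (continuousAt_const.mul (ContinuousAt.inv₀ ?_ (by norm_num)))
        fun_prop
      have h5 := this.tendsto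
      simp only [zero_mul] at h5
      exact h5.mono_left nhdsWithin_le_nhds
    have h6 : |c 0| ≤ 0 := by
      refine ge_of_tendsto ht ?_
      filter_upwards [Ioo_mem_nhdsGT (show (0 : ℝ) < 1 by norm_num)] with z hz using hb z hz
    exact abs_eq_zero.1 (le_antisymm h6 (abs_nonneg _))
  induction k with
  | zero => exact h0
  | succ k ih =>
    intro c hc h
    refine ih (fun j => c (j + 1)) (fun j => hc _) fun z hz => ?_
    have h1 := h z hz
    rw [(hsum c hc z hz).tsum_eq_zero_add, h0 c hc h] at h1
    have h2 : ∑' j, c (j + 1) * z ^ (j + 1) = z * ∑' j, c (j + 1) * z ^ j := by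
      rw [← tsum_mul_left]; congr 1; ext j; ring
    rw [h2] at h1
    simpa [hz.1.ne'] using h1

theorem summable_geometric_two_var {z w : ℝ} (hz : z ∈ Set.Ioo (0 : ℝ) 1)
    (hw : w ∈ Set.Ioo (0 : ℝ) 1) : Summable fun u : ℕ × ℕ => z ^ u.1 * w ^ u.2 :=
  (summable_geometric_of_lt_one hz.1.le hz.2).mul_of_nonneg
    (summable_geometric_of_lt_one hw.1.le hw.2) (fun j => pow_nonneg hz.1.le j)
    (fun j => pow_nonneg hw.1.le j)

theorem eq_zero_of_tsum_mul_pow_mul_pow_eq_zero {c : ℕ → ℕ → ℝ} (hc : ∀ s t, |c s t| ≤ 1)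
    (h : ∀ z ∈ Set.Ioo (0 : ℝ) 1, ∀ w ∈ Set.Ioo (0 : ℝ) 1,
      ∑' u : ℕ × ℕ, c u.1 u.2 * (z ^ u.1 * w ^ u.2) = 0) (s t : ℕ) : c s t = 0 := by
  refine eq_zero_of_tsum_mul_pow_eq_zero t (c s) (hc s) fun w hw => ?_
  have hbd : ∀ s, |∑' t, c s t * w ^ t| ≤ (1 - w)⁻¹ := by
    intro s
    rw [← Real.norm_eq_abs]
    refine tsum_of_norm_bounded (hasSum_geometric_of_lt_one hw.1.le hw.2) fun j => ?_
    rw [Real.norm_eq_abs, abs_mul, abs_of_nonneg (pow_nonneg hw.1.le j)]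
    exact mul_le_of_le_one_left (pow_nonneg hw.1.le j) (hc _ _)
  refine eq_zero_of_tsum_mul_pow_eq_zero s (fun s => ∑' t, c s t * w ^ t) hbd fun z hz => ?_
  rw [← h z hz w hw, Summable.tsum_prod]
  · congr 1; ext s; rw [← tsum_mul_right]; congr 1; ext t; ring
  · refine Summable.of_norm_bounded (summable_geometric_two_var hz hw) fun u => ?_
    have h0 : 0 ≤ z ^ u.1 * w ^ u.2 := mul_nonneg (pow_nonneg hz.1.le _) (pow_nonneg hw.1.le _)
    rw [Real.norm_eq_abs, abs_mul, abs_of_nonneg h0]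
    exact mul_le_of_le_one_left h0 (hc _ _)

/-- Continuity theorem for probability generating functions on `ℕ × ℕ`. -/
theorem tendsto_mass_of_tendsto_pgf {F : ℕ → ℕ → ℕ → ℝ} {G : ℕ → ℕ → ℝ}
    (hF : ∀ᶠ n in atTop, ∀ s t, F n s t ∈ Set.Icc (0 : ℝ) 1)
    (hG : ∀ s t, G s t ∈ Set.Icc (0 : ℝ) 1)
    (h : ∀ z ∈ Set.Ioo (0 : ℝ) 1, ∀ w ∈ Set.Ioo (0 : ℝ) 1,
      Tendsto (fun n => ∑' u : ℕ × ℕ, F n u.1 u.2 * (z ^ u.1 * w ^ u.2)) atTop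
        (𝓝 (∑' u : ℕ × ℕ, G u.1 u.2 * (z ^ u.1 * w ^ u.2)))) (s t : ℕ) :
    Tendsto (fun n => F n s t) atTop (𝓝 (G s t)) := by
  rw [tendsto_iff_ultrafilter]
  intro U hU
  have hcl : ∀ s t, ∃ x ∈ Set.Icc (0 : ℝ) 1, Tendsto (fun n => F n s t) U (𝓝 x) := by
    intro s t
    exact (isCompact_Icc (a := (0 : ℝ)) (b := 1)).ultrafilter_le_nhds (U.map fun n => F n s t)
      (by
        rw [le_principal_iff]
        exact hU (hF.mono fun n hn => hn s t))
  choose H hH hHlim using hcl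
  have hbound : ∀ x ∈ Set.Icc (0 : ℝ) 1, ∀ y : ℝ, 0 ≤ y → ‖x * y‖ ≤ y := by
    intro x hx y hy
    rw [Real.norm_eq_abs, abs_of_nonneg (mul_nonneg hx.1 hy)]
    exact mul_le_of_le_one_left hy hx.2
  suffices hGH : H s t = G s t by rw [← hGH]; exact hHlim s t
  rw [← sub_eq_zero]
  refine eq_zero_of_tsum_mul_pow_mul_pow_eq_zero (c := fun s t => H s t - G s t)
    (fun s t => abs_le.2 ⟨?_, ?_⟩) (fun z hz w hw => ?_) s t
  · have := (hH s t).1; have := (hG s t).2; linarith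
  · have := (hH s t).2; have := (hG s t).1; linarith
  have hpos : ∀ u : ℕ × ℕ, 0 ≤ z ^ u.1 * w ^ u.2 := fun u =>
    mul_nonneg (pow_nonneg hz.1.le _) (pow_nonneg hw.1.le _)
  have hs := summable_geometric_two_var hz hw
  have h1 : Tendsto (fun n => ∑' u : ℕ × ℕ, F n u.1 u.2 * (z ^ u.1 * w ^ u.2)) U
      (𝓝 (∑' u : ℕ × ℕ, H u.1 u.2 * (z ^ u.1 * w ^ u.2))) := by
    refine tendsto_tsum_of_dominated_convergence hs (fun u => (hHlim _ _).mul_const _) ?_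
    exact hU (hF.mono fun n hn u => hbound _ (hn _ _) _ (hpos u))
  have h2 := tendsto_nhds_unique h1 ((h z hz w hw).mono_left hU)
  simp only [sub_mul]
  rw [Summable.tsum_sub, h2, sub_self]
  · exact Summable.of_norm_bounded hs fun u => hbound _ (hH _ _) _ (hpos u)
  · exact Summable.of_norm_bounded hs fun u => hbound _ (hG _ _) _ (hpos u)

/-! ### Continuity of Spearman's rank correlation -/

/-- Scheffé's lemma for mass functions. -/
theorem tendsto_tsum_abs_sub {ι : Type*} {F : ℕ → ι → ℝ} {G : ι → ℝ}
    (hF0 : ∀ᶠ n in atTop, ∀ u, 0 ≤ F n u) (hF1 : ∀ᶠ n in atTop, HasSum (F n) 1)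
    (hG0 : ∀ u, 0 ≤ G u) (hG1 : HasSum G 1)
    (h : ∀ u, Tendsto (fun n => F n u) atTop (𝓝 (G u))) :
    Tendsto (fun n => ∑' u, |F n u - G u|) atTop (𝓝 0) := by
  have h1 : Tendsto (fun n => ∑' u, max (G u - F n u) 0) atTop (𝓝 (∑' _u : ι, (0 : ℝ))) := by
    refine tendsto_tsum_of_dominated_convergence hG1.summable (fun u => ?_) ?_
    · have := ((tendsto_const_nhds (x := G u)).sub (h u)).max (tendsto_const_nhds (x := (0 : ℝ)))
      simpa using this
    · filter_upwards [hF0] with n hn u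
      rw [Real.norm_eq_abs, abs_of_nonneg (le_max_right _ _)]
      exact max_le (by have := hn u; linarith) (hG0 u)
  rw [tsum_zero] at h1
  have h2 := h1.const_mul 2
  rw [mul_zero] at h2
  refine h2.congr' ?_
  filter_upwards [hF0, hF1] with n h0 hn
  have hm : Summable fun u => max (G u - F n u) 0 :=
    Summable.of_norm_bounded hG1.summable fun u => by
      rw [Real.norm_eq_abs, abs_of_nonneg (le_max_right _ _)]
      exact max_le (by have := h0 u; linarith) (hG0 u)
  have h3 : HasSum (fun u => 2 * max (G u - F n u) 0 - (G u - F n u))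
      (2 * ∑' u, max (G u - F n u) 0 - (1 - 1)) :=
    (hm.hasSum.mul_left 2).sub (hG1.sub hn)
  rw [sub_self, sub_zero] at h3
  rw [← h3.tsum_eq]
  congr 1; ext u
  rcases le_total (G u) (F n u) with h4 | h4
  · rw [max_eq_right (by linarith), abs_of_nonneg (by linarith)]; ring
  · rw [max_eq_left (by linarith), abs_of_nonpos (by linarith)]; ring

theorem tendsto_tsum_mul_mass {ι : Type*} {F : ℕ → ι → ℝ} {G : ι → ℝ}
    (hF0 : ∀ᶠ n in atTop, ∀ u, 0 ≤ F n u) (hF1 : ∀ᶠ n in atTop, HasSum (F n) 1)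
    (hG0 : ∀ u, 0 ≤ G u) (hG1 : HasSum G 1)
    (h : ∀ u, Tendsto (fun n => F n u) atTop (𝓝 (G u)))
    {φ : ℕ → ι → ℝ} {ψ : ι → ℝ} (hφ : ∀ᶠ n in atTop, ∀ u, |φ n u| ≤ 1)
    (hlim : ∀ u, Tendsto (fun n => φ n u) atTop (𝓝 (ψ u))) :
    Tendsto (fun n => ∑' u, φ n u * F n u) atTop (𝓝 (∑' u, ψ u * G u)) := by
  have h1 : Tendsto (fun n => ∑' u, φ n u * G u) atTop (𝓝 (∑' u, ψ u * G u)) := by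
    refine tendsto_tsum_of_dominated_convergence hG1.summable
      (fun u => (hlim u).mul_const _) ?_
    filter_upwards [hφ] with n hn u
    rw [Real.norm_eq_abs, abs_mul, abs_of_nonneg (hG0 u)]
    exact mul_le_of_le_one_left (hG0 u) (hn u)
  have h2 : Tendsto (fun n => ∑' u, φ n u * (F n u - G u)) atTop (𝓝 0) := by
    refine squeeze_zero_norm' ?_ (tendsto_tsum_abs_sub hF0 hF1 hG0 hG1 h)
    filter_upwards [hφ, hF1] with n hn h1
    refine tsum_of_norm_bounded (h1.summable.sub hG1.summable).abs.hasSum fun u => ?_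
    rw [Real.norm_eq_abs, abs_mul]
    exact mul_le_of_le_one_left (abs_nonneg _) (hn u)
  have h3 := h1.add h2
  rw [add_zero] at h3
  refine h3.congr' ?_
  filter_upwards [hφ, hF1, hF0] with n hn h1 h0
  have ha : Summable fun u => φ n u * G u :=
    Summable.of_norm_bounded hG1.summable fun u => by
      rw [Real.norm_eq_abs, abs_mul, abs_of_nonneg (hG0 u)]
      exact mul_le_of_le_one_left (hG0 u) (hn u)
  have hb : Summable fun u => φ n u * (F n u - G u) :=
    Summable.of_norm_bounded (h1.summable.sub hG1.summable).abs fun u => by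
      rw [Real.norm_eq_abs, abs_mul]
      exact mul_le_of_le_one_left (abs_nonneg _) (hn u)
  rw [← ha.tsum_add hb]
  congr 1; ext u; ring

/-- The mid-rank of a point as the average of a weight function. -/
def rankWeight (x u : ℕ) : ℝ := ((if u < x then 1 else 0) + if u ≤ x then 1 else 0) / 2

theorem rankWeight_nonneg (x u : ℕ) : 0 ≤ rankWeight x u := by
  unfold rankWeight; split_ifs <;> norm_num

theorem rankWeight_le_one (x u : ℕ) : rankWeight x u ≤ 1 := by
  unfold rankWeight; split_ifs <;> norm_num

theorem summable_rankWeight_mul {f : ℕ × ℕ → ℝ} (h0 : ∀ u, 0 ≤ f u) (h1 : Summable f)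
    (g : ℕ × ℕ → ℕ) (x : ℕ) : Summable fun u => rankWeight x (g u) * f u :=
  Summable.of_nonneg_of_le (fun u => mul_nonneg (rankWeight_nonneg _ _) (h0 u))
    (fun u => mul_le_of_le_one_left (h0 u) (rankWeight_le_one _ _)) h1

theorem midRank_eq_tsum {f : ℕ → ℝ} (h0 : ∀ u, 0 ≤ f u) (h1 : Summable f) (x : ℕ) :
    midRank f x = ∑' u, rankWeight x u * f u := by
  unfold midRank
  have ha : Summable fun u => if u < x then f u else 0 :=
    Summable.of_nonneg_of_le (fun u => by split_ifs <;> simp [h0])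
      (fun u => by split_ifs <;> simp [h0]) h1
  have hb : Summable fun u => if u ≤ x then f u else 0 :=
    Summable.of_nonneg_of_le (fun u => by split_ifs <;> simp [h0])
      (fun u => by split_ifs <;> simp [h0]) h1
  rw [← ha.tsum_add hb, ← tsum_div_const]
  congr 1; ext u
  unfold rankWeight
  split_ifs <;> ring

theorem midRank_fst {F : ℕ → ℕ → ℝ} (h0 : ∀ s t, 0 ≤ F s t)
    (h1 : Summable fun u : ℕ × ℕ => F u.1 u.2) (x : ℕ) :
    midRank (fun u => ∑' v, F u v) x = ∑' u : ℕ × ℕ, rankWeight x u.1 * F u.1 u.2 := by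
  rw [midRank_eq_tsum (fun u => tsum_nonneg fun v => h0 u v) h1.prod,
    (summable_rankWeight_mul (f := fun u => F u.1 u.2) (fun u => h0 _ _) h1 Prod.fst x).tsum_prod]
  congr 1; ext u; exact tsum_mul_left.symm

theorem midRank_snd {F : ℕ → ℕ → ℝ} (h0 : ∀ s t, 0 ≤ F s t)
    (h1 : Summable fun u : ℕ × ℕ => F u.1 u.2) (x : ℕ) :
    midRank (fun v => ∑' u, F u v) x = ∑' u : ℕ × ℕ, rankWeight x u.2 * F u.1 u.2 := by
  have h1' : Summable fun u : ℕ × ℕ => F u.2 u.1 :=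
    (Equiv.prodComm ℕ ℕ).summable_iff.2 h1
  rw [midRank_fst (F := fun s t => F t s) (fun s t => h0 t s) h1',
    ← (Equiv.prodComm ℕ ℕ).tsum_eq]
  rfl

theorem tsum_sq_mul_sub_sq_pos {ι : Type*} {G : ι → ℝ} (hG0 : ∀ u, 0 ≤ G u)
    (hG1 : HasSum G 1) {φ : ι → ℝ} (hφ : ∀ u, |φ u| ≤ 1) {a b : ι} (ha : 0 < G a)
    (hb : 0 < G b) (hab : φ a ≠ φ b) :
    0 < ∑' u, φ u ^ 2 * G u - (∑' u, φ u * G u) ^ 2 := by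
  set c := ∑' u, φ u * G u with hc
  have hs1 : Summable fun u => φ u * G u :=
    Summable.of_norm_bounded hG1.summable fun u => by
      rw [Real.norm_eq_abs, abs_mul, abs_of_nonneg (hG0 u)]
      exact mul_le_of_le_one_left (hG0 u) (hφ u)
  have hs2 : Summable fun u => φ u ^ 2 * G u :=
    Summable.of_nonneg_of_le (fun u => mul_nonneg (sq_nonneg _) (hG0 u))
      (fun u => mul_le_of_le_one_left (hG0 u) (by
        rw [← sq_abs]; exact pow_le_one₀ (abs_nonneg _) (hφ u))) hG1.summable
  have h : HasSum (fun u => φ u ^ 2 * G u - 2 * c * (φ u * G u) + c ^ 2 * G u)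
      (∑' u, φ u ^ 2 * G u - 2 * c * c + c ^ 2 * 1) :=
    (hs2.hasSum.sub (hs1.hasSum.mul_left _)).add (hG1.mul_left _)
  have he : ∑' u, φ u ^ 2 * G u - c ^ 2 = ∑' u, (φ u - c) ^ 2 * G u := by
    have : (fun u => (φ u - c) ^ 2 * G u) =
      fun u => φ u ^ 2 * G u - 2 * c * (φ u * G u) + c ^ 2 * G u := by ext u; ring
    rw [this, h.tsum_eq]; ring
  have hs : Summable fun u => (φ u - c) ^ 2 * G u := by
    convert h.summable using 2 with u; ring
  rw [he]
  have hne : φ a ≠ c ∨ φ b ≠ c := by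
    by_contra! hcon; exact hab (hcon.1.trans hcon.2.symm)
  rcases hne with h' | h'
  · exact hs.tsum_pos (fun u => mul_nonneg (sq_nonneg _) (hG0 u)) a
      (mul_pos (pow_pos (abs_pos.2 (sub_ne_zero.2 h')) 2 |>.trans_eq (sq_abs _)) ha)
  · exact hs.tsum_pos (fun u => mul_nonneg (sq_nonneg _) (hG0 u)) b
      (mul_pos (pow_pos (abs_pos.2 (sub_ne_zero.2 h')) 2 |>.trans_eq (sq_abs _)) hb)

theorem tsum_rankWeight_lt {f : ℕ × ℕ → ℝ} (h0 : ∀ u, 0 ≤ f u) (h1 : Summable f)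
    (g : ℕ × ℕ → ℕ) {a b : ℕ × ℕ} (ha : 0 < f a) (hab : g a < g b) :
    ∑' u, rankWeight (g a) (g u) * f u < ∑' u, rankWeight (g b) (g u) * f u := by
  refine Summable.tsum_lt_tsum (i := a) (fun u => ?_) ?_ (summable_rankWeight_mul h0 h1 g _)
    (summable_rankWeight_mul h0 h1 g _)
  · refine mul_le_mul_of_nonneg_right ?_ (h0 u)
    unfold rankWeight
    split_ifs <;> first | (exfalso; omega) | norm_num
  · refine mul_lt_mul_of_pos_right ?_ ha
    unfold rankWeight
    rw [if_neg (lt_irrefl _), if_pos le_rfl, if_pos hab, if_pos hab.le]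
    norm_num

theorem tsum_rankWeight_mem {f : ℕ × ℕ → ℝ} (h0 : ∀ u, 0 ≤ f u) (h1 : HasSum f 1)
    (g : ℕ × ℕ → ℕ) (x : ℕ) : |∑' u, rankWeight x (g u) * f u| ≤ 1 := by
  rw [abs_of_nonneg (tsum_nonneg fun u => mul_nonneg (rankWeight_nonneg _ _) (h0 u)),
    ← h1.tsum_eq]
  exact (summable_rankWeight_mul h0 h1.summable g x).tsum_le_tsum
    (fun u => mul_le_of_le_one_left (h0 u) (rankWeight_le_one _ _)) h1.summable

theorem spearman_continuity {F : ℕ → ℕ → ℕ → ℝ} {G : ℕ → ℕ → ℝ}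
    (hF0 : ∀ᶠ n in atTop, ∀ s t, 0 ≤ F n s t)
    (hF1 : ∀ᶠ n in atTop, HasSum (fun u : ℕ × ℕ => F n u.1 u.2) 1)
    (hG0 : ∀ s t, 0 ≤ G s t) (hG1 : HasSum (fun u : ℕ × ℕ => G u.1 u.2) 1)
    (h : ∀ s t, Tendsto (fun n => F n s t) atTop (𝓝 (G s t)))
    (hfst : ∃ a b : ℕ × ℕ, 0 < G a.1 a.2 ∧ 0 < G b.1 b.2 ∧ a.1 < b.1)
    (hsnd : ∃ a b : ℕ × ℕ, 0 < G a.1 a.2 ∧ 0 < G b.1 b.2 ∧ a.2 < b.2) :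
    Tendsto (fun n => spearman (F n)) atTop (𝓝 (spearman G)) := by
  have hF0' : ∀ᶠ n in atTop, ∀ u : ℕ × ℕ, 0 ≤ F n u.1 u.2 := hF0.mono fun n hn u => hn _ _
  have hG0' : ∀ u : ℕ × ℕ, 0 ≤ G u.1 u.2 := fun u => hG0 _ _
  have h' : ∀ u : ℕ × ℕ, Tendsto (fun n => F n u.1 u.2) atTop (𝓝 (G u.1 u.2)) := fun u => h _ _
  set r : (ℕ → ℕ → ℝ) → (ℕ × ℕ → ℕ) → ℕ → ℝ :=
    fun F g x => ∑' u : ℕ × ℕ, rankWeight x (g u) * F u.1 u.2 with hr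
  have key : ∀ {F : ℕ → ℕ → ℝ}, (∀ s t, 0 ≤ F s t) →
      HasSum (fun u : ℕ × ℕ => F u.1 u.2) 1 → spearman F =
        (∑' u : ℕ × ℕ, (r F Prod.fst u.1 * r F Prod.snd u.2) * F u.1 u.2 -
          (∑' u : ℕ × ℕ, r F Prod.fst u.1 * F u.1 u.2) *
            ∑' u : ℕ × ℕ, r F Prod.snd u.2 * F u.1 u.2) /
        (Real.sqrt (∑' u : ℕ × ℕ, r F Prod.fst u.1 ^ 2 * F u.1 u.2 -
            (∑' u : ℕ × ℕ, r F Prod.fst u.1 * F u.1 u.2) ^ 2) *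
          Real.sqrt (∑' u : ℕ × ℕ, r F Prod.snd u.2 ^ 2 * F u.1 u.2 -
            (∑' u : ℕ × ℕ, r F Prod.snd u.2 * F u.1 u.2) ^ 2)) := by
    intro F h0 h1
    unfold spearman pmean
    simp only [midRank_fst h0 h1.summable, midRank_snd h0 h1.summable, hr]
  have hrb : ∀ᶠ n in atTop, ∀ g x, |r (F n) g x| ≤ 1 := by
    filter_upwards [hF0', hF1] with n h0 h1 g x using tsum_rankWeight_mem h0 h1 g x
  have hrG : ∀ g x, |r G g x| ≤ 1 := fun g x => tsum_rankWeight_mem hG0' hG1 g x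
  have hrlim : ∀ g x, Tendsto (fun n => r (F n) g x) atTop (𝓝 (r G g x)) := by
    intro g x
    refine tendsto_tsum_mul_mass hF0' hF1 hG0' hG1 h' (.of_forall fun n u => ?_)
      fun u => tendsto_const_nhds
    rw [abs_of_nonneg (rankWeight_nonneg _ _)]
    exact rankWeight_le_one _ _
  have hmean : ∀ g : ℕ × ℕ → ℕ, Tendsto (fun n => ∑' u : ℕ × ℕ, r (F n) g (g u) * F n u.1 u.2)
      atTop (𝓝 (∑' u : ℕ × ℕ, r G g (g u) * G u.1 u.2)) := fun g =>
    tendsto_tsum_mul_mass hF0' hF1 hG0' hG1 h' (hrb.mono fun n hn u => hn _ _)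
      fun u => hrlim _ _
  have hsq : ∀ g : ℕ × ℕ → ℕ,
      Tendsto (fun n => ∑' u : ℕ × ℕ, r (F n) g (g u) ^ 2 * F n u.1 u.2)
      atTop (𝓝 (∑' u : ℕ × ℕ, r G g (g u) ^ 2 * G u.1 u.2)) := fun g =>
    tendsto_tsum_mul_mass hF0' hF1 hG0' hG1 h' (hrb.mono fun n hn u => by
      rw [abs_pow]; exact pow_le_one₀ (abs_nonneg _) (hn _ _))
      fun u => (hrlim _ _).pow 2
  have hprod : Tendsto (fun n => ∑' u : ℕ × ℕ,
      (r (F n) Prod.fst u.1 * r (F n) Prod.snd u.2) * F n u.1 u.2) atTop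
      (𝓝 (∑' u : ℕ × ℕ, (r G Prod.fst u.1 * r G Prod.snd u.2) * G u.1 u.2)) :=
    tendsto_tsum_mul_mass hF0' hF1 hG0' hG1 h' (hrb.mono fun n hn u => by
      rw [abs_mul]; exact mul_le_one₀ (hn _ _) (abs_nonneg _) (hn _ _))
      fun u => (hrlim _ _).mul (hrlim _ _)
  have hvar : ∀ g : ℕ × ℕ → ℕ,
      (∃ a b : ℕ × ℕ, 0 < G a.1 a.2 ∧ 0 < G b.1 b.2 ∧ g a < g b) →
      0 < ∑' u : ℕ × ℕ, r G g (g u) ^ 2 * G u.1 u.2 -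
        (∑' u : ℕ × ℕ, r G g (g u) * G u.1 u.2) ^ 2 := by
    rintro g ⟨a, b, ha, hb, hab⟩
    exact tsum_sq_mul_sub_sq_pos hG0' hG1 (φ := fun u => r G g (g u)) (fun u => hrG _ _) ha hb
      (tsum_rankWeight_lt hG0' hG1.summable g ha hab).ne
  rw [key hG0 hG1]
  refine Tendsto.congr' (f₁ := fun n => _) ?_ (Tendsto.div
    (hprod.sub ((hmean Prod.fst).mul (hmean Prod.snd)))
    ((((hsq Prod.fst).sub ((hmean Prod.fst).pow 2)).sqrt).mul
      (((hsq Prod.snd).sub ((hmean Prod.snd).pow 2)).sqrt)) ?_)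
  · filter_upwards [hF0, hF1] with n h0 h1
    exact (key h0 h1).symm
  · exact mul_ne_zero (Real.sqrt_pos.2 (hvar Prod.fst hfst)).ne'
      (Real.sqrt_pos.2 (hvar Prod.snd hsnd)).ne'

/-! ### Generating functions of convolutions -/

theorem hasSum_conv_pgf {f g : ℕ → ℝ} (hf : ∀ s, 0 ≤ f s) (hg : ∀ s, 0 ≤ g s) {z a b : ℝ}
    (hz : 0 ≤ z) (ha : HasSum (fun s => f s * z ^ s) a) (hb : HasSum (fun s => g s * z ^ s) b) :
    HasSum (fun s => conv f g s * z ^ s) (a * b) := by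
  have hs := ha.summable.mul_of_nonneg hb.summable
    (fun s => mul_nonneg (hf s) (pow_nonneg hz s)) (fun s => mul_nonneg (hg s) (pow_nonneg hz s))
  have h := ha.mul hb hs
  rw [← Finset.HasAntidiagonal.sigmaAntidiagonalEquivProd.hasSum_iff] at h
  refine (h.sigma fun s => hasSum_fintype _).congr_fun ?_
  intro s
  unfold conv
  rw [← Finset.Nat.sum_antidiagonal_eq_sum_range_succ fun i j => f i * g j, Finset.sum_mul,
    ← Finset.sum_coe_sort]
  refine Finset.sum_congr rfl fun x _ => ?_
  have := Finset.HasAntidiagonal.mem_antidiagonal.1 x.2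
  simp only [Function.comp, Finset.HasAntidiagonal.sigmaAntidiagonalEquivProd_apply]
  have e : z ^ s = z ^ x.1.1 * z ^ x.1.2 := by rw [← pow_add, this]
  rw [e]; ring

theorem conv_nonneg {f g : ℕ → ℝ} (hf : ∀ s, 0 ≤ f s) (hg : ∀ s, 0 ≤ g s) (s : ℕ) :
    0 ≤ conv f g s := Finset.sum_nonneg fun _ _ => mul_nonneg (hf _) (hg _)

theorem convPow_nonneg {f : ℕ → ℝ} (hf : ∀ s, 0 ≤ f s) (j : ℕ) : ∀ s, 0 ≤ convPow f j s := by
  induction j with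
  | zero => intro s; simp only [convPow]; split_ifs <;> norm_num
  | succ j ih => exact conv_nonneg hf ih

theorem hasSum_convPow_pgf {f : ℕ → ℝ} (hf : ∀ s, 0 ≤ f s) {z a : ℝ} (hz : 0 ≤ z)
    (ha : HasSum (fun s => f s * z ^ s) a) (j : ℕ) :
    HasSum (fun s => convPow f j s * z ^ s) (a ^ j) := by
  induction j with
  | zero =>
    have := hasSum_single (f := fun s => convPow f 0 s * z ^ s) 0
      (fun s hs => by simp [convPow, hs])
    simpa [convPow] using this
  | succ j ih => rw [pow_succ']; exact hasSum_conv_pgf hf (convPow_nonneg hf j) hz ha ih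

theorem hasSum_cpoi_pgf {f : ℕ → ℝ} (hf : ∀ s, 0 ≤ f s) {lam z a : ℝ} (hlam : 0 ≤ lam)
    (hz : 0 ≤ z) (ha : HasSum (fun s => f s * z ^ s) a) :
    HasSum (fun s => cpoi lam f s * z ^ s) (Real.exp (lam * (a - 1))) := by
  set T : ℕ × ℕ → ℝ := fun p =>
    Real.exp (-lam) * lam ^ p.1 / (p.1.factorial : ℝ) * convPow f p.1 p.2 * z ^ p.2 with hT
  have hT0 : 0 ≤ T := fun p => mul_nonneg (mul_nonneg (by positivity) (convPow_nonneg hf _ _))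
    (pow_nonneg hz _)
  have hrow : ∀ j, HasSum (fun s => T (j, s))
      (Real.exp (-lam) * lam ^ j / (j.factorial : ℝ) * a ^ j) := fun j => by
    have := (hasSum_convPow_pgf hf hz ha j).mul_left
      (Real.exp (-lam) * lam ^ j / (j.factorial : ℝ))
    simpa only [hT, mul_assoc] using this
  have htot : HasSum (fun j : ℕ => Real.exp (-lam) * lam ^ j / (j.factorial : ℝ) * a ^ j)
      (Real.exp (lam * (a - 1))) := by
    have h := (NormedSpace.expSeries_div_hasSum_exp (lam * a)).mul_left (Real.exp (-lam))
    rw [← Real.exp_eq_exp_ℝ, ← Real.exp_add] at h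
    have e : lam * (a - 1) = -lam + lam * a := by ring
    rw [e]
    refine h.congr_fun fun j => ?_
    rw [mul_pow]; ring
  have hsum : Summable T := by
    rw [summable_prod_of_nonneg hT0]
    exact ⟨fun j => (hrow j).summable, by simpa only [(hrow _).tsum_eq] using htot.summable⟩
  have hT1 : HasSum T (Real.exp (lam * (a - 1))) := by
    have := htot.unique (hsum.hasSum.prod_fiberwise hrow)
    rw [this]; exact hsum.hasSum
  have hT2 : HasSum (T ∘ Prod.swap) (Real.exp (lam * (a - 1))) :=
    (Equiv.prodComm ℕ ℕ).hasSum_iff.2 hT1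
  refine (hT2.prod_fiberwise fun s => (hT2.summable.prod_factor s).hasSum).congr_fun fun s => ?_
  unfold cpoi
  rw [← tsum_mul_right]
  rfl

theorem cpoi_nonneg {f : ℕ → ℝ} (hf : ∀ s, 0 ≤ f s) {lam : ℝ} (hlam : 0 ≤ lam) (s : ℕ) :
    0 ≤ cpoi lam f s :=
  tsum_nonneg fun _ => mul_nonneg (by positivity) (convPow_nonneg hf _ _)

/-- Pairs `(u, v)` of points of `ℕ × ℕ`, grouped by their sum. -/
def sigmaSumEquiv : (Σ p : ℕ × ℕ, (Finset.range (p.1 + 1) ×ˢ Finset.range (p.2 + 1) :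
    Finset (ℕ × ℕ))) ≃ (ℕ × ℕ) × (ℕ × ℕ) where
  toFun x := (x.2.1, (x.1.1 - x.2.1.1, x.1.2 - x.2.1.2))
  invFun x := ⟨(x.1.1 + x.2.1, x.1.2 + x.2.2), ⟨x.1, by
    simp only [Finset.mem_product, Finset.mem_range]; omega⟩⟩
  left_inv x := by
    obtain ⟨⟨s, t⟩, ⟨⟨i, j⟩, h⟩⟩ := x
    simp only [Finset.mem_product, Finset.mem_range] at h
    refine Sigma.subtype_ext ?_ rfl
    simp only [Prod.mk.injEq]; omega
  right_inv x := by
    obtain ⟨⟨s, t⟩, ⟨i, j⟩⟩ := x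
    simp

theorem hasSum_conv2_pgf {F G : ℕ → ℕ → ℝ} (hF : ∀ s t, 0 ≤ F s t) (hG : ∀ s t, 0 ≤ G s t)
    {z w a b : ℝ} (hz : 0 ≤ z) (hw : 0 ≤ w)
    (ha : HasSum (fun u : ℕ × ℕ => F u.1 u.2 * (z ^ u.1 * w ^ u.2)) a)
    (hb : HasSum (fun u : ℕ × ℕ => G u.1 u.2 * (z ^ u.1 * w ^ u.2)) b) :
    HasSum (fun u : ℕ × ℕ => conv2 F G u.1 u.2 * (z ^ u.1 * w ^ u.2)) (a * b) := by
  have hs := ha.summable.mul_of_nonneg hb.summable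
    (fun u => mul_nonneg (hF _ _) (by positivity)) (fun u => mul_nonneg (hG _ _) (by positivity))
  have h := ha.mul hb hs
  rw [← sigmaSumEquiv.hasSum_iff] at h
  refine (h.sigma fun s => hasSum_fintype _).congr_fun ?_
  rintro ⟨s, t⟩
  simp only [conv2]
  rw [← Finset.sum_product', Finset.sum_mul, ← Finset.sum_coe_sort]
  refine Finset.sum_congr rfl fun x _ => ?_
  obtain ⟨⟨i, j⟩, h⟩ := x
  simp only [Finset.mem_product, Finset.mem_range] at h
  obtain ⟨k, rfl⟩ := Nat.exists_eq_add_of_le (Nat.lt_succ_iff.1 h.1)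
  obtain ⟨l, rfl⟩ := Nat.exists_eq_add_of_le (Nat.lt_succ_iff.1 h.2)
  simp only [Function.comp, sigmaSumEquiv, Equiv.coe_fn_mk, Nat.add_sub_cancel_left]
  rw [pow_add, pow_add]; ring

theorem conv2_nonneg {F G : ℕ → ℕ → ℝ} (hF : ∀ s t, 0 ≤ F s t) (hG : ∀ s t, 0 ≤ G s t)
    (s t : ℕ) : 0 ≤ conv2 F G s t :=
  Finset.sum_nonneg fun _ _ => Finset.sum_nonneg fun _ _ => mul_nonneg (hF _ _) (hG _ _)

theorem conv2_pos {F G : ℕ → ℕ → ℝ} (hF : ∀ s t, 0 ≤ F s t) (hG : ∀ s t, 0 ≤ G s t)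
    {s t a b : ℕ} (h1 : 0 < F s t) (h2 : 0 < G a b) : 0 < conv2 F G (s + a) (t + b) := by
  refine (mul_pos h1 h2).trans_le ?_
  unfold conv2
  calc F s t * G a b ≤ ∑ j ∈ Finset.range (t + b + 1), F s j * G (s + a - s) (t + b - j) := by
        have := Finset.single_le_sum
          (f := fun j => F s j * G (s + a - s) (t + b - j)) (s := Finset.range (t + b + 1))
          (fun _ _ => mul_nonneg (hF _ _) (hG _ _)) (a := t) (by simp)
        simpa using this
    _ ≤ _ := Finset.single_le_sum
          (f := fun i => ∑ j ∈ Finset.range (t + b + 1), F i j * G (s + a - i) (t + b - j))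
          (fun _ _ => Finset.sum_nonneg fun _ _ => mul_nonneg (hF _ _) (hG _ _))
          (by simp)

theorem delta11_nonneg (s t : ℕ) : 0 ≤ delta11 s t := by
  unfold delta11; split_ifs <;> norm_num

theorem hasSum_delta11_pgf (z w : ℝ) :
    HasSum (fun u : ℕ × ℕ => delta11 u.1 u.2 * (z ^ u.1 * w ^ u.2)) (z * w) := by
  have := hasSum_single (f := fun u : ℕ × ℕ => delta11 u.1 u.2 * (z ^ u.1 * w ^ u.2)) (1, 1)
    (fun u hu => by
      have : ¬ (u.1 = 1 ∧ u.2 = 1) := fun h => hu (Prod.ext h.1 h.2)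
      simp [delta11, this])
  simpa [delta11] using this

theorem hasSum_binP_pgf (x : ℕ) (y z : ℝ) :
    HasSum (fun s => binP x y s * z ^ s) ((1 - y + y * z) ^ x) := by
  have h : HasSum (fun s => binP x y s * z ^ s)
      (∑ s ∈ Finset.range (x + 1), binP x y s * z ^ s) :=
    hasSum_sum_of_ne_finset_zero fun s hs => by
      have : x < s := by simpa [Nat.lt_succ_iff] using hs
      simp [binP, Nat.choose_eq_zero_of_lt this]
  convert h using 1
  rw [add_comm, add_pow]
  refine Finset.sum_congr rfl fun s _ => ?_
  unfold binP
  rw [mul_pow]; ring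

theorem binP_nonneg {y : ℝ} (hy : y ∈ Set.Icc (0 : ℝ) 1) (x s : ℕ) : 0 ≤ binP x y s := by
  have h0 := hy.1
  have h1 : 0 ≤ 1 - y := sub_nonneg.2 hy.2
  unfold binP; positivity

/-- The generating function `z ↦ 1 - y + y z` of a Bernoulli variable. -/
def bernPgf (y z : ℝ) : ℝ := 1 - y + y * z

theorem bernPgf_one (y : ℝ) : bernPgf y 1 = 1 := by unfold bernPgf; ring

theorem bernPgf_mem {y z : ℝ} (hy : y ∈ Set.Icc (0 : ℝ) 1) (hz : z ∈ Set.Icc (0 : ℝ) 1) :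
    bernPgf y z ∈ Set.Icc (0 : ℝ) 1 := by
  obtain ⟨h0, h1⟩ := hy
  obtain ⟨h2, h3⟩ := hz
  unfold bernPgf
  exact ⟨by nlinarith, by nlinarith⟩

theorem continuous_bernPgf_pow (z : ℝ) (k : ℕ) : Continuous fun y => bernPgf y z ^ k := by
  unfold bernPgf; fun_prop

theorem continuous_binP (x s : ℕ) : Continuous fun y => binP x y s := by
  unfold binP; fun_prop

theorem measurable_of_continuous_snd {f : ℕ × ℝ → ℝ} (h : ∀ a, Continuous fun y => f (a, y)) :
    Measurable f :=
  (continuous_prod_of_discrete_left.2 h).measurable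

section Limit

variable {P : Measure (ℕ × ℝ)}

/-- The generating function of `gInc`. -/
def gPgf (P : Measure (ℕ × ℝ)) (z : ℝ) : ℝ :=
  (∫ p, (p.1 : ℝ) * bernPgf p.2 z ^ (p.1 - 1) ∂P) / mom P 1 0

/-- The generating function of `f2p`. -/
def f2pPgf (P : Measure (ℕ × ℝ)) (z w : ℝ) : ℝ :=
  (∫ p, (p.1.descFactorial 2 : ℝ) * p.2 * (bernPgf p.2 z ^ (p.1 - 2) *
    bernPgf p.2 w ^ (p.1 - 2)) ∂P) / mom P 2 1

theorem hasSum_gInc_pgf (hP : ∀ᵐ p ∂P, p.2 ∈ Set.Icc (0 : ℝ) 1)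
    (hint : Integrable (fun p : ℕ × ℝ => (p.1 : ℝ)) P) {z : ℝ} (hz : z ∈ Set.Icc (0 : ℝ) 1) :
    HasSum (fun s => gInc P s * z ^ s) (gPgf P z) := by
  have hs : ∀ p : ℕ × ℝ, HasSum (fun s => (p.1 : ℝ) * binP (p.1 - 1) p.2 s * z ^ s)
      ((p.1 : ℝ) * bernPgf p.2 z ^ (p.1 - 1)) := fun p => by
    simpa only [mul_assoc, bernPgf] using (hasSum_binP_pgf (p.1 - 1) p.2 z).mul_left (p.1 : ℝ)
  have h := hasSum_integral_of_dominated_convergence (μ := P)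
    (F := fun s p => (p.1 : ℝ) * binP (p.1 - 1) p.2 s * z ^ s)
    (f := fun p => (p.1 : ℝ) * bernPgf p.2 z ^ (p.1 - 1))
    (fun s p => (p.1 : ℝ) * binP (p.1 - 1) p.2 s * z ^ s)
    (fun s => (measurable_of_continuous_snd fun a => by
      have := continuous_binP (a - 1) s; dsimp only; fun_prop).aestronglyMeasurable)
    (fun s => hP.mono fun p hp => by
      have := binP_nonneg hp (p.1 - 1) s
      have := hz.1
      rw [Real.norm_eq_abs, abs_of_nonneg (by positivity)])
    (.of_forall fun p => (hs p).summable)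
    (by
      simp only [(hs _).tsum_eq]
      refine hint.mono (measurable_of_continuous_snd fun a => by
        have := continuous_bernPgf_pow z (a - 1); dsimp only; fun_prop).aestronglyMeasurable
        (hP.mono fun p hp => ?_)
      have := bernPgf_mem hp hz
      rw [norm_mul, Real.norm_eq_abs (_ ^ _), abs_of_nonneg (pow_nonneg this.1 _)]
      exact mul_le_of_le_one_right (norm_nonneg _) (pow_le_one₀ this.1 this.2))
    (.of_forall hs)
  have h' := h.div_const (mom P 1 0)
  refine h'.congr_fun fun s => ?_
  unfold gInc
  rw [integral_mul_const]; ring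

theorem hasSum_f2p_pgf (hP : ∀ᵐ p ∂P, p.2 ∈ Set.Icc (0 : ℝ) 1)
    (hint : Integrable (fun p : ℕ × ℝ => (p.1.descFactorial 2 : ℝ) * p.2) P) {z w : ℝ}
    (hz : z ∈ Set.Icc (0 : ℝ) 1) (hw : w ∈ Set.Icc (0 : ℝ) 1) :
    HasSum (fun u : ℕ × ℕ => f2p P u.1 u.2 * (z ^ u.1 * w ^ u.2)) (f2pPgf P z w) := by
  set F : ℕ × ℕ → ℕ × ℝ → ℝ := fun u p => (p.1.descFactorial 2 : ℝ) * p.2 *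
    binP (p.1 - 2) p.2 u.1 * binP (p.1 - 2) p.2 u.2 * (z ^ u.1 * w ^ u.2) with hF
  have hs : ∀ᵐ p ∂P, HasSum (fun u => F u p) ((p.1.descFactorial 2 : ℝ) * p.2 *
      (bernPgf p.2 z ^ (p.1 - 2) * bernPgf p.2 w ^ (p.1 - 2))) := hP.mono fun p hp => by
    have h1 := hasSum_binP_pgf (p.1 - 2) p.2 z
    have h2 := hasSum_binP_pgf (p.1 - 2) p.2 w
    have h3 := (h1.mul h2 (h1.summable.mul_of_nonneg h2.summable
      (fun s => mul_nonneg (binP_nonneg hp _ _) (pow_nonneg hz.1 _))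
      (fun s => mul_nonneg (binP_nonneg hp _ _) (pow_nonneg hw.1 _)))).mul_left
      ((p.1.descFactorial 2 : ℝ) * p.2)
    refine h3.congr_fun fun u => ?_
    simp only [hF]; ring
  have h := hasSum_integral_of_dominated_convergence (μ := P) (F := F)
    (f := fun p => (p.1.descFactorial 2 : ℝ) * p.2 *
      (bernPgf p.2 z ^ (p.1 - 2) * bernPgf p.2 w ^ (p.1 - 2))) F
    (fun s => (measurable_of_continuous_snd fun a => by
      have := continuous_binP (a - 2) s.1
      have := continuous_binP (a - 2) s.2
      simp only [hF]; fun_prop).aestronglyMeasurable)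
    (fun s => hP.mono fun p hp => by
      have := binP_nonneg hp (p.1 - 2) s.1
      have := binP_nonneg hp (p.1 - 2) s.2
      have := hz.1
      have := hw.1
      have := hp.1
      rw [Real.norm_eq_abs, abs_of_nonneg (by positivity)])
    (hs.mono fun p hp => hp.summable)
    (by
      refine Integrable.congr ?_ (hs.mono fun p hp => hp.tsum_eq.symm)
      refine hint.mono (measurable_of_continuous_snd fun a => by
        have := continuous_bernPgf_pow z (a - 2)
        have := continuous_bernPgf_pow w (a - 2); dsimp only; fun_prop).aestronglyMeasurable
        (hP.mono fun p hp => ?_)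
      have h1 := bernPgf_mem hp hz
      have h2 := bernPgf_mem hp hw
      have h3 := pow_nonneg h1.1 (p.1 - 2)
      have h4 := pow_nonneg h2.1 (p.1 - 2)
      rw [norm_mul, Real.norm_eq_abs (_ ^ _ * _), abs_of_nonneg (mul_nonneg h3 h4)]
      exact mul_le_of_le_one_right (norm_nonneg _)
        (mul_le_one₀ (pow_le_one₀ h1.1 h1.2) h4 (pow_le_one₀ h2.1 h2.2)))
    hs
  have h' := h.div_const (mom P 2 1)
  refine h'.congr_fun fun u => ?_
  unfold f2p
  rw [hF, integral_mul_const]; ring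

theorem gInc_nonneg (hP : ∀ᵐ p ∂P, p.2 ∈ Set.Icc (0 : ℝ) 1) (h10 : 0 < mom P 1 0) (s : ℕ) :
    0 ≤ gInc P s :=
  div_nonneg (integral_nonneg_of_ae (hP.mono fun _ hp =>
    mul_nonneg (Nat.cast_nonneg _) (binP_nonneg hp _ _))) h10.le

theorem f2p_nonneg (hP : ∀ᵐ p ∂P, p.2 ∈ Set.Icc (0 : ℝ) 1) (h21 : 0 < mom P 2 1) (s t : ℕ) :
    0 ≤ f2p P s t :=
  div_nonneg (integral_nonneg_of_ae (hP.mono fun _ hp =>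
    mul_nonneg (mul_nonneg (mul_nonneg (Nat.cast_nonneg _) hp.1) (binP_nonneg hp _ _))
      (binP_nonneg hp _ _))) h21.le

theorem barf1_nonneg (hP : ∀ᵐ p ∂P, p.2 ∈ Set.Icc (0 : ℝ) 1) (h10 : 0 < mom P 1 0)
    {mu : ℝ} (hmu : 0 < mu) (s : ℕ) : 0 ≤ barf1 mu P s :=
  cpoi_nonneg (gInc_nonneg hP h10) (mul_pos hmu h10).le s

/-- The generating function of `barf2`. -/
def barPgf (mu : ℝ) (P : Measure (ℕ × ℝ)) (z w : ℝ) : ℝ :=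
  z * w * (Real.exp (mu * mom P 1 0 * (gPgf P z - 1)) *
    Real.exp (mu * mom P 1 0 * (gPgf P w - 1))) * f2pPgf P z w

theorem hasSum_barf1_pgf (hP : ∀ᵐ p ∂P, p.2 ∈ Set.Icc (0 : ℝ) 1) (h10 : 0 < mom P 1 0)
    (hint : Integrable (fun p : ℕ × ℝ => (p.1 : ℝ)) P) {mu : ℝ} (hmu : 0 < mu) {z : ℝ}
    (hz : z ∈ Set.Icc (0 : ℝ) 1) :
    HasSum (fun s => barf1 mu P s * z ^ s) (Real.exp (mu * mom P 1 0 * (gPgf P z - 1))) :=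
  hasSum_cpoi_pgf (gInc_nonneg hP h10) (mul_pos hmu h10).le hz.1 (hasSum_gInc_pgf hP hint hz)

theorem barf2_nonneg (hP : ∀ᵐ p ∂P, p.2 ∈ Set.Icc (0 : ℝ) 1) (h10 : 0 < mom P 1 0)
    (h21 : 0 < mom P 2 1) {mu : ℝ} (hmu : 0 < mu) (s t : ℕ) : 0 ≤ barf2 mu P s t :=
  conv2_nonneg (conv2_nonneg delta11_nonneg fun _ _ =>
    mul_nonneg (barf1_nonneg hP h10 hmu _) (barf1_nonneg hP h10 hmu _)) (f2p_nonneg hP h21) s t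

theorem hasSum_barf2_pgf (hP : ∀ᵐ p ∂P, p.2 ∈ Set.Icc (0 : ℝ) 1) (h10 : 0 < mom P 1 0)
    (h21 : 0 < mom P 2 1) (hint10 : Integrable (fun p : ℕ × ℝ => (p.1 : ℝ)) P)
    (hint21 : Integrable (fun p : ℕ × ℝ => (p.1.descFactorial 2 : ℝ) * p.2) P)
    {mu : ℝ} (hmu : 0 < mu) {z w : ℝ}
    (hz : z ∈ Set.Icc (0 : ℝ) 1) (hw : w ∈ Set.Icc (0 : ℝ) 1) :
    HasSum (fun u : ℕ × ℕ => barf2 mu P u.1 u.2 * (z ^ u.1 * w ^ u.2)) (barPgf mu P z w) := by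
  have hb := barf1_nonneg hP h10 hmu
  have h1 := hasSum_barf1_pgf hP h10 hint10 hmu hz
  have h2 := hasSum_barf1_pgf hP h10 hint10 hmu hw
  have h3 := h1.mul h2 (h1.summable.mul_of_nonneg h2.summable
      (fun s => mul_nonneg (hb s) (pow_nonneg hz.1 _))
      (fun s => mul_nonneg (hb s) (pow_nonneg hw.1 _)))
  refine hasSum_conv2_pgf (conv2_nonneg delta11_nonneg fun _ _ => mul_nonneg (hb _) (hb _))
    (f2p_nonneg hP h21) hz.1 hw.1 (hasSum_conv2_pgf delta11_nonneg
      (fun _ _ => mul_nonneg (hb _) (hb _)) hz.1 hw.1 (hasSum_delta11_pgf z w)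
      (h3.congr_fun fun u => ?_)) (hasSum_f2p_pgf hP hint21 hz hw)
  ring

theorem gPgf_one (h10 : 0 < mom P 1 0) : gPgf P 1 = 1 := by
  unfold gPgf
  simp only [bernPgf_one, one_pow, mul_one]
  rw [div_eq_one_iff_eq h10.ne']
  simp [mom]

theorem f2pPgf_one (h21 : 0 < mom P 2 1) : f2pPgf P 1 1 = 1 := by
  unfold f2pPgf
  simp only [bernPgf_one, one_pow, mul_one]
  rw [div_eq_one_iff_eq h21.ne']
  simp [mom]

theorem barPgf_one {mu : ℝ} (h10 : 0 < mom P 1 0) (h21 : 0 < mom P 2 1) :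
    barPgf mu P 1 1 = 1 := by
  simp [barPgf, gPgf_one h10, f2pPgf_one h21]

theorem gPgf_zero_lt_one (hP : ∀ᵐ p ∂P, p.2 ∈ Set.Icc (0 : ℝ) 1) (h10 : 0 < mom P 1 0)
    (h21 : 0 < mom P 2 1) (hint : Integrable (fun p : ℕ × ℝ => (p.1 : ℝ)) P) :
    gPgf P 0 < 1 := by
  have hz : (0 : ℝ) ∈ Set.Icc (0 : ℝ) 1 := by simp
  have hle : (fun p : ℕ × ℝ => (p.1 : ℝ) * bernPgf p.2 0 ^ (p.1 - 1)) ≤ᵐ[P]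
      fun p => (p.1 : ℝ) := hP.mono fun p hp => by
    have := bernPgf_mem hp hz
    exact mul_le_of_le_one_right (Nat.cast_nonneg _) (pow_le_one₀ this.1 this.2)
  have hi : Integrable (fun p : ℕ × ℝ => (p.1 : ℝ) * bernPgf p.2 0 ^ (p.1 - 1)) P := by
    refine hint.mono (measurable_of_continuous_snd fun a => by
        have := continuous_bernPgf_pow 0 (a - 1); dsimp only; fun_prop).aestronglyMeasurable
        (hP.mono fun p hp => ?_)
    have := bernPgf_mem hp hz
    rw [norm_mul, Real.norm_eq_abs (_ ^ _), abs_of_nonneg (pow_nonneg this.1 _)]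
    exact mul_le_of_le_one_right (norm_nonneg _) (pow_le_one₀ this.1 this.2)
  have hmom : mom P 1 0 = ∫ p, (p.1 : ℝ) ∂P := by simp [mom]
  unfold gPgf
  rw [div_lt_one h10, hmom]
  refine lt_of_le_of_ne (integral_mono_ae hi hint hle) fun heq => ?_
  have hae := (integral_eq_iff_of_ae_le hi hint hle).1 heq
  refine h21.ne' ?_
  unfold mom
  refine integral_eq_zero_of_ae ?_
  filter_upwards [hae, hP] with p hp hy
  simp only [Pi.zero_apply, pow_one]
  rcases Nat.lt_or_ge p.1 2 with h | h
  · rw [Nat.descFactorial_of_lt h]; simp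
  · have hx : (p.1 : ℝ) ≠ 0 := by positivity
    have h1 : bernPgf p.2 0 ^ (p.1 - 1) = 1 := by
      apply mul_left_cancel₀ hx; rw [hp, mul_one]
    have h2 : bernPgf p.2 0 = 1 :=
      (pow_eq_one_iff_of_nonneg (bernPgf_mem hy hz).1 (by omega)).1 h1
    have h3 : p.2 = 0 := by unfold bernPgf at h2; linarith
    rw [h3]; ring

theorem exists_barf2_pos (hP : ∀ᵐ p ∂P, p.2 ∈ Set.Icc (0 : ℝ) 1) (h10 : 0 < mom P 1 0)
    (h21 : 0 < mom P 2 1) (hint10 : Integrable (fun p : ℕ × ℝ => (p.1 : ℝ)) P)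
    (hint21 : Integrable (fun p : ℕ × ℝ => (p.1.descFactorial 2 : ℝ) * p.2) P)
    {mu : ℝ} (hmu : 0 < mu) :
    ∃ s t k : ℕ, 0 < k ∧ 0 < barf2 mu P s t ∧ 0 < barf2 mu P (s + k) t ∧
      0 < barf2 mu P s (t + k) := by
  have hb := barf1_nonneg hP h10 hmu
  have hlam := mul_pos hmu h10
  have h0 : barf1 mu P 0 = Real.exp (mu * mom P 1 0 * (gPgf P 0 - 1)) := by
    have h := hasSum_barf1_pgf hP h10 hint10 hmu (z := 0) (by simp)
    have h' := hasSum_single (f := fun s => barf1 mu P s * (0 : ℝ) ^ s) 0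
      (fun s hs => by simp [hs])
    simpa using h'.unique h
  have hlt : barf1 mu P 0 < 1 := by
    rw [h0, Real.exp_lt_one_iff]
    exact mul_neg_of_pos_of_neg hlam (by linarith [gPgf_zero_lt_one hP h10 h21 hint10])
  have hpos : 0 < barf1 mu P 0 := by rw [h0]; exact Real.exp_pos _
  obtain ⟨k, hk, hkpos⟩ : ∃ k, 0 < k ∧ 0 < barf1 mu P k := by
    by_contra! hcon
    have h := hasSum_barf1_pgf hP h10 hint10 hmu (z := 1) (by simp)
    have h' := hasSum_single (f := fun s => barf1 mu P s * (1 : ℝ) ^ s) 0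
      (fun s hs => by simp [le_antisymm (hcon s (Nat.pos_of_ne_zero hs)) (hb s)])
    have := h'.unique h
    rw [gPgf_one h10] at this
    simp at this
    linarith
  obtain ⟨a, b, hab⟩ : ∃ a b, 0 < f2p P a b := by
    by_contra! hcon
    have h := hasSum_f2p_pgf hP hint21 (z := 1) (w := 1) (by simp) (by simp)
    rw [f2pPgf_one h21] at h
    have h' : (fun u : ℕ × ℕ => f2p P u.1 u.2 * ((1 : ℝ) ^ u.1 * 1 ^ u.2)) = fun _ => 0 := by
      ext u; simp [le_antisymm (hcon u.1 u.2) (f2p_nonneg hP h21 u.1 u.2)]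
    rw [h'] at h
    exact zero_ne_one (hasSum_zero.unique h)
  have hbb : ∀ s t, 0 ≤ barf1 mu P s * barf1 mu P t := fun s t => mul_nonneg (hb s) (hb t)
  have key : ∀ i j, 0 < barf1 mu P i → 0 < barf1 mu P j →
      0 < barf2 mu P (1 + i + a) (1 + j + b) := fun i j hi hj =>
    conv2_pos (conv2_nonneg delta11_nonneg hbb) (f2p_nonneg hP h21)
      (conv2_pos delta11_nonneg hbb (by simp [delta11]) (mul_pos hi hj)) hab
  refine ⟨1 + 0 + a, 1 + 0 + b, k, hk, key 0 0 hpos hpos, ?_, ?_⟩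
  · have := key k 0 hkpos hpos
    rwa [show 1 + k + a = 1 + 0 + a + k by omega] at this
  · have := key 0 k hpos hkpos
    rwa [show 1 + k + b = 1 + 0 + b + k by omega] at this

end Limit

/-! ### Convergence of integrals against the layer type distributions -/

theorem measurableSet_fst_le (K : ℕ) : MeasurableSet {p : ℕ × ℝ | p.1 ≤ K} :=
  measurable_fst measurableSet_Iic

theorem ae_of_measure_eq_one {α : Type*} [MeasurableSpace α] {Q : Measure α}
    [IsProbabilityMeasure Q] {s : Set α} (hs : MeasurableSet s) (h : Q s = 1) :
    ∀ᵐ p ∂Q, p ∈ s :=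
  (prob_compl_eq_zero_iff hs).2 h

theorem tendsto_setIntegral_of_weak {Pn : ℕ → ProbabilityMeasure (ℕ × ℝ)}
    {P : ProbabilityMeasure (ℕ × ℝ)} (hweak : Tendsto Pn atTop (𝓝 P))
    (hPn : ∀ n, ∀ᵐ p ∂(Pn n : Measure (ℕ × ℝ)), p.2 ∈ Set.Icc (0 : ℝ) 1)
    (hP : ∀ᵐ p ∂(P : Measure (ℕ × ℝ)), p.2 ∈ Set.Icc (0 : ℝ) 1)
    {f : ℕ × ℝ → ℝ} (hf : ∀ a, Continuous fun y => f (a, y)) (K : ℕ) :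
    Tendsto (fun n => ∫ p in {p : ℕ × ℝ | p.1 ≤ K}, f p ∂(Pn n : Measure (ℕ × ℝ))) atTop
      (𝓝 (∫ p in {p : ℕ × ℝ | p.1 ≤ K}, f p ∂(P : Measure (ℕ × ℝ)))) := by
  set g : ℕ × ℝ → ℝ := fun p =>
    if p.1 ≤ K then f (p.1, Set.projIcc (0 : ℝ) 1 zero_le_one p.2) else 0 with hg
  have hgc : Continuous g := continuous_prod_of_discrete_left.2 fun a => by
    by_cases ha : a ≤ K
    · simp only [hg, ha, if_true]
      exact (hf a).comp (continuous_subtype_val.comp continuous_projIcc)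
    · simp only [hg, ha, if_false]
      exact continuous_const
  have hb : ∀ a, ∃ C, ∀ y ∈ Set.Icc (0 : ℝ) 1, ‖f (a, y)‖ ≤ C := fun a =>
    isCompact_Icc.exists_bound_of_continuousOn (hf a).continuousOn
  choose C hC using hb
  have hgb : ∀ p, ‖g p‖ ≤ ∑ a ∈ Finset.range (K + 1), |C a| := fun p => by
    simp only [hg]
    split_ifs with h
    · refine (hC p.1 _ (Subtype.prop _)).trans ((le_abs_self _).trans ?_)
      exact Finset.single_le_sum (f := fun a => |C a|) (fun _ _ => abs_nonneg _)
        (Finset.mem_range.2 (Nat.lt_succ_of_le h))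
    · simpa using Finset.sum_nonneg fun a _ => abs_nonneg (C a)
  have key : ∀ Q : ProbabilityMeasure (ℕ × ℝ),
      (∀ᵐ p ∂(Q : Measure (ℕ × ℝ)), p.2 ∈ Set.Icc (0 : ℝ) 1) →
      ∫ p, g p ∂(Q : Measure (ℕ × ℝ)) =
        ∫ p in {p : ℕ × ℝ | p.1 ≤ K}, f p ∂(Q : Measure (ℕ × ℝ)) := fun Q hQ => by
    rw [← integral_indicator (measurableSet_fst_le K)]
    refine integral_congr_ae (hQ.mono fun p hp => ?_)
    simp only [hg, Set.indicator_apply, Set.mem_ofPred_eq]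
    rw [Set.projIcc_of_mem _ hp]
  have h := (ProbabilityMeasure.tendsto_iff_forall_integral_tendsto.1 hweak)
    (BoundedContinuousFunction.ofNormedAddCommGroup g hgc _ hgb)
  simp only [BoundedContinuousFunction.coe_ofNormedAddCommGroup] at h
  rw [key P hP] at h
  exact h.congr fun n => key (Pn n) (hPn n)

theorem tendsto_integral_of_truncated {Pn : ℕ → Measure (ℕ × ℝ)} {P : Measure (ℕ × ℝ)}
    {f : ℕ → ℕ × ℝ → ℝ} {g h : ℕ × ℝ → ℝ}
    (hn : ∀ n, Integrable h (Pn n)) (hP : Integrable h P)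
    (hh : Tendsto (fun n => ∫ p, h p ∂Pn n) atTop (𝓝 (∫ p, h p ∂P)))
    (hhK : ∀ K : ℕ, Tendsto (fun n => ∫ p in {p : ℕ × ℝ | p.1 ≤ K}, h p ∂Pn n) atTop
      (𝓝 (∫ p in {p : ℕ × ℝ | p.1 ≤ K}, h p ∂P)))
    (hfm : ∀ n, AEStronglyMeasurable (f n) (Pn n)) (hgm : AEStronglyMeasurable g P)
    (hf : ∀ n, ∀ᵐ p ∂Pn n, |f n p| ≤ h p) (hg : ∀ᵐ p ∂P, |g p| ≤ h p)
    (hfK : ∀ K : ℕ, Tendsto (fun n => ∫ p in {p : ℕ × ℝ | p.1 ≤ K}, f n p ∂Pn n) atTop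
      (𝓝 (∫ p in {p : ℕ × ℝ | p.1 ≤ K}, g p ∂P))) :
    Tendsto (fun n => ∫ p, f n p ∂Pn n) atTop (𝓝 (∫ p, g p ∂P)) := by
  have hfi : ∀ n, Integrable (f n) (Pn n) := fun n => (hn n).mono' (hfm n) (hf n)
  have hgi : Integrable g P := hP.mono' hgm hg
  have htail : Tendsto (fun K : ℕ => ∫ p in {p : ℕ × ℝ | p.1 ≤ K}, h p ∂P) atTop
      (𝓝 (∫ p, h p ∂P)) := by
    have := tendsto_setIntegral_of_monotone (μ := P) (f := h)
      (s := fun K : ℕ => {p : ℕ × ℝ | p.1 ≤ K}) measurableSet_fst_le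
      (fun a b hab p (hp : p.1 ≤ a) => hp.trans hab) hP.integrableOn
    have hU : (⋃ K : ℕ, {p : ℕ × ℝ | p.1 ≤ K}) = Set.univ :=
      Set.eq_univ_of_forall fun p => Set.mem_iUnion.2 ⟨p.1, by simp⟩
    rwa [hU, setIntegral_univ] at this
  have split : ∀ (Q : Measure (ℕ × ℝ)) (u v : ℕ × ℝ → ℝ) (K : ℕ), Integrable u Q →
      Integrable v Q → (∀ᵐ p ∂Q, |u p| ≤ v p) →
      |∫ p, u p ∂Q - ∫ p in {p : ℕ × ℝ | p.1 ≤ K}, u p ∂Q| ≤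
        ∫ p, v p ∂Q - ∫ p in {p : ℕ × ℝ | p.1 ≤ K}, v p ∂Q := fun Q u v K hu hv huv => by
    rw [← integral_add_compl (measurableSet_fst_le K) hu,
      ← integral_add_compl (measurableSet_fst_le K) hv, add_sub_cancel_left,
      add_sub_cancel_left]
    refine (abs_integral_le_integral_abs).trans ?_
    exact integral_mono_ae hu.abs.integrableOn hv.integrableOn (ae_restrict_of_ae huv)
  rw [Metric.tendsto_atTop']
  intro ε hε
  obtain ⟨K, hK⟩ := ((tendsto_order.1 htail).1 (∫ p, h p ∂P - ε / 4) (by linarith)).exists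
  have h1 := (tendsto_order.1 (hh.sub (hhK K))).2 (ε / 4) (by linarith)
  have h2 := Metric.tendsto_nhds.1 (hfK K) (ε / 4) (by linarith)
  obtain ⟨N, hN⟩ := eventually_atTop.1 (h1.and h2)
  refine ⟨N, fun n hnN => ?_⟩
  obtain ⟨h3, h4⟩ := hN n hnN.le
  rw [Real.dist_eq] at h4 ⊢
  have h5 := split (Pn n) (f n) h K (hfi n) (hn n) (hf n)
  have h6 := split P g h K hgi hP hg
  rw [abs_le] at h5 h6
  rw [abs_lt] at h4 ⊢
  constructor <;> linarith [h4.1, h4.2, h5.1, h5.2, h6.1, h6.2]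

theorem integrable_of_bounded_support {Q : Measure (ℕ × ℝ)} [IsFiniteMeasure Q] {n : ℕ}
    (hQ : ∀ᵐ p ∂Q, p.1 ≤ n ∧ p.2 ∈ Set.Icc (0 : ℝ) 1) {f : ℕ × ℝ → ℝ}
    (hf : ∀ a, Continuous fun y => f (a, y)) : Integrable f Q := by
  have hb : ∀ a, ∃ C, ∀ y ∈ Set.Icc (0 : ℝ) 1, ‖f (a, y)‖ ≤ C := fun a =>
    isCompact_Icc.exists_bound_of_continuousOn (hf a).continuousOn
  choose C hC using hb
  refine Integrable.of_bound (measurable_of_continuous_snd hf).aestronglyMeasurable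
    (∑ a ∈ Finset.range (n + 1), |C a|) (hQ.mono fun p hp => ?_)
  refine (hC p.1 _ hp.2).trans ((le_abs_self _).trans ?_)
  exact Finset.single_le_sum (f := fun a => |C a|) (fun _ _ => abs_nonneg _)
    (Finset.mem_range.2 (Nat.lt_succ_of_le hp.1))

section Weak

variable {Pn : ℕ → ProbabilityMeasure (ℕ × ℝ)} {P : ProbabilityMeasure (ℕ × ℝ)}

theorem tendsto_integral_of_weak_of_le (hweak : Tendsto Pn atTop (𝓝 P))
    (hPn : ∀ n, ∀ᵐ p ∂(Pn n : Measure (ℕ × ℝ)), p.1 ≤ n ∧ p.2 ∈ Set.Icc (0 : ℝ) 1)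
    (hP : ∀ᵐ p ∂(P : Measure (ℕ × ℝ)), p.2 ∈ Set.Icc (0 : ℝ) 1)
    {f h : ℕ × ℝ → ℝ} (hf : ∀ a, Continuous fun y => f (a, y))
    (hh : ∀ a, Continuous fun y => h (a, y)) (hint : Integrable h (P : Measure (ℕ × ℝ)))
    (hconv : Tendsto (fun n => ∫ p, h p ∂(Pn n : Measure (ℕ × ℝ))) atTop
      (𝓝 (∫ p, h p ∂(P : Measure (ℕ × ℝ)))))
    (hle : ∀ a, ∀ y ∈ Set.Icc (0 : ℝ) 1, |f (a, y)| ≤ h (a, y)) :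
    Tendsto (fun n => ∫ p, f p ∂(Pn n : Measure (ℕ × ℝ))) atTop
      (𝓝 (∫ p, f p ∂(P : Measure (ℕ × ℝ)))) :=
  tendsto_integral_of_truncated (fun n => integrable_of_bounded_support (hPn n) hh) hint hconv
    (fun K => tendsto_setIntegral_of_weak hweak (fun n => (hPn n).mono fun _ hp => hp.2) hP hh K)
    (fun _ => (measurable_of_continuous_snd hf).aestronglyMeasurable)
    (measurable_of_continuous_snd hf).aestronglyMeasurable
    (fun n => (hPn n).mono fun p hp => hle p.1 p.2 hp.2)
    (hP.mono fun p hp => hle p.1 p.2 hp)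
    (fun K => tendsto_setIntegral_of_weak hweak (fun n => (hPn n).mono fun _ hp => hp.2) hP hf K)

theorem tendsto_integral_mul_div_zero (hweak : Tendsto Pn atTop (𝓝 P))
    (hPn : ∀ n, ∀ᵐ p ∂(Pn n : Measure (ℕ × ℝ)), p.1 ≤ n ∧ p.2 ∈ Set.Icc (0 : ℝ) 1)
    (hP : ∀ᵐ p ∂(P : Measure (ℕ × ℝ)), p.2 ∈ Set.Icc (0 : ℝ) 1)
    {h : ℕ × ℝ → ℝ}
    (hh : ∀ a, Continuous fun y => h (a, y)) (hint : Integrable h (P : Measure (ℕ × ℝ)))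
    (hconv : Tendsto (fun n => ∫ p, h p ∂(Pn n : Measure (ℕ × ℝ))) atTop
      (𝓝 (∫ p, h p ∂(P : Measure (ℕ × ℝ)))))
    (h0 : ∀ a, ∀ y ∈ Set.Icc (0 : ℝ) 1, 0 ≤ h (a, y)) :
    Tendsto (fun n : ℕ => ∫ p, h p * (p.1 / n) ∂(Pn n : Measure (ℕ × ℝ))) atTop (𝓝 0) := by
  have hc : ∀ n : ℕ, ∀ a : ℕ, Continuous fun y => h (a, y) * ((a : ℝ) / n) := fun n a => by
    exact (hh a).mul_const _
  have h0n : ∀ n, ∀ᵐ p ∂(Pn n : Measure (ℕ × ℝ)), 0 ≤ h p ∧ p.1 ≤ n := fun n =>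
    (hPn n).mono fun p hp => ⟨h0 p.1 p.2 hp.2, hp.1⟩
  have key := tendsto_integral_of_truncated (Pn := fun n => (Pn n : Measure (ℕ × ℝ)))
    (P := (P : Measure (ℕ × ℝ))) (g := fun _ => 0)
    (f := fun n p => h p * (p.1 / n))
    (fun n => integrable_of_bounded_support (hPn n) hh) hint hconv
    (fun K => tendsto_setIntegral_of_weak hweak (fun n => (hPn n).mono fun _ hp => hp.2) hP hh K)
    (fun n => (measurable_of_continuous_snd (hc n)).aestronglyMeasurable)
    aestronglyMeasurable_const
    (fun n => (h0n n).mono fun p hp => by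
      have h1 : (p.1 : ℝ) / n ≤ 1 := div_le_one_of_le₀ (by exact_mod_cast hp.2) (by positivity)
      have h2 : 0 ≤ (p.1 : ℝ) / n := by positivity
      rw [abs_of_nonneg (mul_nonneg hp.1 h2)]
      exact mul_le_of_le_one_right hp.1 h1)
    (hP.mono fun p hp => by simpa using h0 p.1 p.2 hp)
    (fun K => by
      simp only [integral_zero]
      have hz : Tendsto (fun n : ℕ => (K : ℝ) / n * ∫ p, h p ∂(Pn n : Measure (ℕ × ℝ))) atTop
          (𝓝 0) := by
        simpa using (tendsto_const_div_atTop_nhds_zero_nat (K : ℝ)).mul hconv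
      refine squeeze_zero (fun n => ?_) (fun n => ?_) hz
      · refine integral_nonneg_of_ae (ae_restrict_of_ae ((h0n n).mono fun p hp => ?_))
        exact mul_nonneg hp.1 (by positivity)
      · rw [← integral_const_mul, ← integral_indicator (measurableSet_fst_le K)]
        refine integral_mono_of_nonneg ((h0n n).mono fun p hp => ?_)
          ((integrable_of_bounded_support (hPn n) hh).const_mul _)
          ((h0n n).mono fun p hp => ?_)
        · exact Set.indicator_apply_nonneg fun _ => mul_nonneg hp.1 (by positivity)
        · simp only [Set.indicator_apply, Set.mem_ofPred_eq]
          split_ifs with hK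
          · rw [mul_comm]
            refine mul_le_mul_of_nonneg_right ?_ hp.1
            gcongr
          · exact mul_nonneg (by positivity) hp.1)
  simpa using key

end Weak

/-! ### The law of a single layer -/

theorem bern_singleton (y : ℝ) (b : Bool) :
    bern y {b} = ((bif b then min (Real.toNNReal y) 1 else 1 - min (Real.toNNReal y) 1 : NNReal) :
      ℝ≥0∞) := by
  unfold bern
  rw [PMF.toMeasure_apply_singleton _ _ (measurableSet_singleton b)]
  cases b <;> rfl

theorem measurable_bern_singleton (b : Bool) : Measurable fun y => bern y {b} := by
  simp only [bern_singleton]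
  cases b <;> simp only [cond_true, cond_false] <;> fun_prop

theorem bern_singleton_toReal {y : ℝ} (hy : y ∈ Set.Icc (0 : ℝ) 1) (b : Bool) :
    (bern y {b}).toReal = if b then y else 1 - y := by
  have h1 : Real.toNNReal y ≤ 1 := by simpa using hy.2
  rw [bern_singleton, min_eq_left h1]
  cases b
  · rw [cond_false, ENNReal.coe_toReal, NNReal.coe_sub h1, Real.coe_toNNReal _ hy.1]; simp
  · simp [Real.coe_toNNReal _ hy.1]

theorem measurable_edgeFactor_singleton (n : ℕ) (V : Finset (Fin n)) (e : Sym2 (Fin n))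
    (b : Bool) : Measurable fun y => edgeFactor n V y e {b} := by
  unfold edgeFactor
  split_ifs
  · exact measurable_bern_singleton b
  · exact measurable_const

theorem edgeFactor_singleton_toReal {n : ℕ} (V : Finset (Fin n)) {y : ℝ}
    (hy : y ∈ Set.Icc (0 : ℝ) 1) (e : Sym2 (Fin n)) (b : Bool) :
    (edgeFactor n V y e {b}).toReal = if ¬ e.IsDiag ∧ ∀ v ∈ e, v ∈ V then
      (if b then y else 1 - y) else if b then 0 else 1 := by
  unfold edgeFactor
  split_ifs with h hb hb
  · rw [bern_singleton_toReal hy, if_pos hb]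
  · rw [bern_singleton_toReal hy, if_neg hb]
  · subst hb; simp
  · have : b = false := by simpa using hb
    subst this; simp

theorem edgeMeasure_singleton (n : ℕ) (V : Finset (Fin n)) (y : ℝ) (f : Sym2 (Fin n) → Bool) :
    edgeMeasure n V y {f} = ∏ e, edgeFactor n V y e {f e} :=
  Measure.pi_singleton _ _

theorem measurable_edgeMeasure_singleton (n : ℕ) (V : Finset (Fin n))
    (f : Sym2 (Fin n) → Bool) : Measurable fun y => edgeMeasure n V y {f} := by
  simp only [edgeMeasure_singleton]
  exact Finset.measurable_prod _ fun e _ => measurable_edgeFactor_singleton n V e (f e)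

theorem vertexMeasure_singleton_toReal {n x : ℕ} (hx : x ≤ n) (V : Finset (Fin n)) :
    (vertexMeasure n x {V}).toReal = if V.card = x then ((n.choose x : ℝ))⁻¹ else 0 := by
  have h : (Finset.powersetCard x (Finset.univ : Finset (Fin n))).Nonempty := by
    rw [Finset.powersetCard_nonempty]; simpa using hx
  unfold vertexMeasure
  rw [dif_pos h, PMF.toMeasure_apply_singleton _ _ (measurableSet_singleton V),
    PMF.uniformOfFinset_apply]
  simp only [Finset.mem_powersetCard, Finset.subset_univ, true_and, Finset.card_powersetCard,
    Finset.card_univ, Fintype.card_fin]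
  split_ifs <;> simp

theorem layerFiber_apply (n : ℕ) (p : ℕ × ℝ) {s : Set (Layer n)} (hs : MeasurableSet s) :
    ((vertexMeasure n p.1).bind fun V => (edgeMeasure n V p.2).map fun f => (p, V, f)) s =
      ∑ V, (∑ f, s.indicator 1 ((p, V, f) : Layer n) * edgeMeasure n V p.2 {f}) *
        vertexMeasure n p.1 {V} := by
  rw [Measure.bind_apply hs Measurable.of_discrete.aemeasurable, lintegral_fintype]
  refine Finset.sum_congr rfl fun V _ => ?_
  congr 1
  rw [Measure.map_apply Measurable.of_discrete hs,
    ← lintegral_indicator_one (Measurable.of_discrete hs), lintegral_fintype]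
  rfl

theorem measurable_layerFiber (n : ℕ) : Measurable fun p : ℕ × ℝ =>
    (vertexMeasure n p.1).bind fun V =>
      (edgeMeasure n V p.2).map fun f => ((p, V, f) : Layer n) := by
  refine Measure.measurable_of_measurable_coe _ fun s hs => ?_
  simp only [layerFiber_apply n _ hs]
  refine Finset.measurable_sum _ fun V _ => Measurable.mul (Finset.measurable_sum _ fun f _ =>
    Measurable.mul ?_ ((measurable_edgeMeasure_singleton n V f).comp measurable_snd)) ?_
  · have : Measurable (s.indicator (1 : Layer n → ℝ≥0∞)) := measurable_one.indicator hs
    exact this.comp (measurable_id.prodMk measurable_const)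
  · exact (Measurable.of_discrete (f := fun x : ℕ => vertexMeasure n x {V})).comp measurable_fst

instance (n : ℕ) (Q : Measure (ℕ × ℝ)) [IsProbabilityMeasure Q] :
    IsProbabilityMeasure (layerMeasure n Q) := by
  constructor
  unfold layerMeasure
  rw [Measure.bind_apply MeasurableSet.univ (measurable_layerFiber n).aemeasurable]
  have : ∀ p : ℕ × ℝ, ((vertexMeasure n p.1).bind fun V =>
      (edgeMeasure n V p.2).map fun f => ((p, V, f) : Layer n)) Set.univ = 1 := fun p => by
    rw [Measure.bind_apply MeasurableSet.univ Measurable.of_discrete.aemeasurable]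
    have : ∀ V, ((edgeMeasure n V p.2).map fun f => ((p, V, f) : Layer n)) Set.univ = 1 :=
      fun V => by rw [Measure.map_apply Measurable.of_discrete MeasurableSet.univ]; simp
    simp [this]
  simp [this]

theorem layerMeasure_real_snd {n : ℕ} (Q : Measure (ℕ × ℝ)) [IsProbabilityMeasure Q]
    (V : Finset (Fin n)) (f : Sym2 (Fin n) → Bool) :
    ((layerMeasure n Q).map Prod.snd).real {(V, f)} =
      ∫ p, (vertexMeasure n p.1 {V}).toReal * (edgeMeasure n V p.2 {f}).toReal ∂Q := by
  have hs : MeasurableSet (Prod.snd ⁻¹' {(V, f)} : Set (Layer n)) :=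
    measurable_snd (measurableSet_singleton _)
  rw [Measure.real, Measure.map_apply measurable_snd (measurableSet_singleton _)]
  unfold layerMeasure
  rw [Measure.bind_apply hs (measurable_layerFiber n).aemeasurable]
  have key : ∀ p : ℕ × ℝ, ((vertexMeasure n p.1).bind fun V =>
      (edgeMeasure n V p.2).map fun f => ((p, V, f) : Layer n)) (Prod.snd ⁻¹' {(V, f)}) =
      vertexMeasure n p.1 {V} * edgeMeasure n V p.2 {f} := fun p => by
    rw [layerFiber_apply n p hs, Finset.sum_eq_single V, Finset.sum_eq_single f]
    · simp [mul_comm]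
    · intro g _ hg; simp [hg]
    · simp
    · intro W _ hW; simp [hW]
    · simp
  simp only [key]
  have hm : Measurable fun p : ℕ × ℝ =>
      vertexMeasure n p.1 {V} * edgeMeasure n V p.2 {f} :=
    ((Measurable.of_discrete (f := fun x : ℕ => vertexMeasure n x {V})).comp measurable_fst).mul
      ((measurable_edgeMeasure_singleton n V f).comp measurable_snd)
  rw [← integral_toReal hm.aemeasurable (.of_forall fun p =>
    ENNReal.mul_lt_top (measure_lt_top _ _) (measure_lt_top _ _))]
  simp only [ENNReal.toReal_mul]

theorem integral_layerMeasure {n : ℕ} {Q : Measure (ℕ × ℝ)} [IsProbabilityMeasure Q]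
    (φ : Finset (Fin n) × (Sym2 (Fin n) → Bool) → ℝ) :
    ∫ L, φ L.2 ∂layerMeasure n Q = ∫ p, ∑ V, (vertexMeasure n p.1 {V}).toReal *
      ∑ f, (edgeMeasure n V p.2 {f}).toReal * φ (V, f) ∂Q := by
  have hφ : Measurable φ := Measurable.of_discrete
  have : IsProbabilityMeasure ((layerMeasure n Q).map Prod.snd) :=
    Measure.isProbabilityMeasure_map measurable_snd.aemeasurable
  have hi : ∀ (V : Finset (Fin n)) (f : Sym2 (Fin n) → Bool), Integrable
      (fun p : ℕ × ℝ => (vertexMeasure n p.1 {V}).toReal * (edgeMeasure n V p.2 {f}).toReal) Q :=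
    fun V f => by
      refine Integrable.of_bound (Measurable.aestronglyMeasurable (Measurable.mul ?_ ?_)) 1
        (.of_forall fun p => ?_)
      · exact (Measurable.of_discrete
          (f := fun x : ℕ => (vertexMeasure n x {V}).toReal)).comp measurable_fst
      · exact ((measurable_edgeMeasure_singleton n V f).comp measurable_snd).ennreal_toReal
      · rw [Real.norm_eq_abs, abs_of_nonneg (by positivity)]
        exact mul_le_one₀ measureReal_le_one ENNReal.toReal_nonneg measureReal_le_one
  rw [← integral_map (φ := Prod.snd) (f := φ) measurable_snd.aemeasurable
    hφ.aestronglyMeasurable, integral_fintype Integrable.of_finite, Fintype.sum_prod_type,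
    integral_finsetSum _ fun V _ => ?_]
  · refine Finset.sum_congr rfl fun V _ => ?_
    simp only [Finset.mul_sum, ← mul_assoc]
    rw [integral_finsetSum _ fun f _ => (hi V f).mul_const _]
    refine Finset.sum_congr rfl fun f _ => ?_
    rw [layerMeasure_real_snd, integral_mul_const, smul_eq_mul]
  · simp only [Finset.mul_sum, ← mul_assoc]
    exact integrable_finsetSum _ fun f _ => (hi V f).mul_const _

/-- A pair of nodes that can be linked in a layer with node set `V`. -/
def IsPairIn {n : ℕ} (V : Finset (Fin n)) (e : Sym2 (Fin n)) : Prop :=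
  ¬ e.IsDiag ∧ ∀ v ∈ e, v ∈ V

theorem mem_layerEdges {n : ℕ} {L : Layer n} {e : Sym2 (Fin n)} :
    e ∈ layerEdges L ↔ L.2.2 e = true ∧ IsPairIn L.2.1 e := by
  simp [layerEdges, IsPairIn]

theorem integral_layer_prod {n : ℕ} {Q : Measure (ℕ × ℝ)} [IsProbabilityMeasure Q]
    (hQ : ∀ᵐ p ∂Q, p.1 ≤ n ∧ p.2 ∈ Set.Icc (0 : ℝ) 1)
    (ψ : Finset (Fin n) → ℝ) (c d : Sym2 (Fin n) → ℝ) :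
    ∫ L, ψ L.2.1 * ∏ e, (if e ∈ layerEdges L then c e else d e) ∂layerMeasure n Q =
      ∫ p, ((n.choose p.1 : ℝ))⁻¹ * ∑ V ∈ Finset.powersetCard p.1 Finset.univ, ψ V *
        ∏ e, (if IsPairIn V e then p.2 * c e + (1 - p.2) * d e else d e) ∂Q := by
  have h := integral_layerMeasure (Q := Q) (n := n) fun t => ψ t.1 *
    ∏ e, (if t.2 e = true ∧ IsPairIn t.1 e then c e else d e)
  refine Eq.trans (integral_congr_ae (.of_forall fun L => ?_))
    (h.trans (integral_congr_ae (hQ.mono fun p hp => ?_)))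
  · exact congrArg (ψ L.2.1 * ·) (Finset.prod_congr rfl fun e _ =>
      if_congr mem_layerEdges rfl rfl)
  dsimp only
  have hV : ∀ V : Finset (Fin n), ∑ f : Sym2 (Fin n) → Bool, (edgeMeasure n V p.2 {f}).toReal *
      (ψ V * ∏ e, (if f e = true ∧ IsPairIn V e then c e else d e)) = ψ V *
      ∏ e, (if IsPairIn V e then p.2 * c e + (1 - p.2) * d e else d e) := fun V => by
    have h1 : ∀ e, (if IsPairIn V e then p.2 * c e + (1 - p.2) * d e else d e) =
        ∑ b : Bool, (edgeFactor n V p.2 e {b}).toReal *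
          (if b = true ∧ IsPairIn V e then c e else d e) := fun e => by
      simp only [edgeFactor_singleton_toReal V hp.2, Fintype.sum_bool]
      by_cases he : IsPairIn V e
      · have he' := he
        unfold IsPairIn at he'
        simp only [if_pos he', he]
        simp
      · have he' := he
        unfold IsPairIn at he'
        simp only [if_neg he', he]
        simp
    simp only [h1]
    rw [Finset.prod_univ_sum, Fintype.piFinset_univ, Finset.mul_sum]
    refine Finset.sum_congr rfl fun f _ => ?_
    rw [edgeMeasure_singleton, ENNReal.toReal_prod, Finset.prod_mul_distrib]
    ring
  simp only [hV, vertexMeasure_singleton_toReal hp.1, ite_mul, zero_mul]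
  rw [← Finset.sum_filter, Finset.mul_sum]
  refine Finset.sum_congr ?_ fun _ _ => rfl
  ext V
  simp

/-! ### Degree and adjacency statistics of a single layer -/

/-- The degree of node `i` in a layer. -/
def layerDeg {n : ℕ} (L : Layer n) (i : Fin n) : ℕ := ((layerEdges L).filter (i ∈ ·)).card

/-- The weight of an edge in the joint degree generating function of nodes `i` and `j`. -/
def edgeWeight {n : ℕ} (i j : Fin n) (z w : ℝ) (e : Sym2 (Fin n)) : ℝ :=
  (if i ∈ e then z else 1) * (if j ∈ e then w else 1)

theorem pow_layerDeg {n : ℕ} (L : Layer n) (i j : Fin n) (z w : ℝ) :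
    z ^ layerDeg L i * w ^ layerDeg L j =
      ∏ e, if e ∈ layerEdges L then edgeWeight i j z w e else 1 := by
  rw [Finset.prod_ite_mem, Finset.univ_inter]
  simp only [edgeWeight]
  rw [Finset.prod_mul_distrib, ← Finset.prod_filter, ← Finset.prod_filter, Finset.prod_const,
    Finset.prod_const]
  rfl

theorem prod_pairs_at {n : ℕ} {V : Finset (Fin n)} {i : Fin n} (hi : i ∈ V)
    (g : Sym2 (Fin n) → ℝ) :
    ∏ e with IsPairIn V e ∧ i ∈ e, g e = ∏ v ∈ V.erase i, g s(i, v) := by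
  refine (Finset.prod_bij (fun v _ => s(i, v)) ?_ ?_ ?_ fun _ _ => rfl).symm
  · intro v hv
    rw [Finset.mem_erase] at hv
    rw [Finset.mem_filter_univ, IsPairIn, Sym2.mk_isDiag_iff]
    simp only [Sym2.mem_iff]
    refine ⟨⟨fun h => hv.1 h.symm, ?_⟩, by simp⟩
    rintro u (rfl | rfl)
    exacts [hi, hv.2]
  · intro v _ u _ h
    exact Sym2.congr_right.1 h
  · intro e he
    rw [Finset.mem_filter_univ, IsPairIn] at he
    obtain ⟨⟨hd, hV⟩, hie⟩ := he
    obtain ⟨v, rfl⟩ := Sym2.mem_iff_exists.1 hie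
    refine ⟨v, Finset.mem_erase.2 ⟨fun h => hd ?_, hV v (by simp)⟩, rfl⟩
    simp [h]

theorem prod_pairs {n : ℕ} (V : Finset (Fin n)) {i j : Fin n} (hij : i ≠ j)
    {g : Sym2 (Fin n) → ℝ} (hg : ∀ e, i ∉ e → j ∉ e → g e = 1) :
    ∏ e, (if IsPairIn V e then g e else 1) =
      (if i ∈ V then ∏ v ∈ V.erase i, g s(i, v) else 1) *
        if j ∈ V then ∏ v ∈ (V.erase i).erase j, g s(j, v) else 1 := by
  rw [← Finset.prod_filter, ← Finset.prod_filter_mul_prod_filter_not _ (i ∈ ·),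
    Finset.filter_filter, Finset.filter_filter]
  congr 1
  · split_ifs with hi
    · exact prod_pairs_at hi g
    · rw [Finset.filter_false_of_mem, Finset.prod_empty]
      rintro e - ⟨he, hie⟩
      exact hi (he.2 i hie)
  · have h1 : (Finset.univ.filter fun e => IsPairIn V e ∧ i ∉ e) =
        Finset.univ.filter (IsPairIn (V.erase i)) := by
      ext e
      rw [Finset.mem_filter_univ, Finset.mem_filter_univ, IsPairIn, IsPairIn]
      simp only [Finset.mem_erase]
      constructor
      · rintro ⟨⟨hd, hV⟩, hi⟩
        exact ⟨hd, fun v hv => ⟨fun h => hi (h ▸ hv), hV v hv⟩⟩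
      · rintro ⟨hd, hV⟩
        exact ⟨⟨hd, fun v hv => (hV v hv).2⟩, fun hi => (hV i hi).1 rfl⟩
    rw [h1, ← Finset.prod_filter_mul_prod_filter_not _ (j ∈ ·), Finset.filter_filter,
      Finset.filter_filter]
    have h2 : ∏ e with IsPairIn (V.erase i) e ∧ j ∉ e, g e = 1 := by
      refine Finset.prod_eq_one fun e he => ?_
      rw [Finset.mem_filter_univ, IsPairIn] at he
      simp only [Finset.mem_erase] at he
      exact hg e (fun hi => (he.1.2 i hi).1 rfl) he.2
    rw [h2, mul_one]
    split_ifs with hj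
    · exact prod_pairs_at (Finset.mem_erase.2 ⟨hij.symm, hj⟩) g
    · rw [Finset.filter_false_of_mem, Finset.prod_empty]
      rintro e - ⟨he, hje⟩
      exact hj (Finset.mem_of_mem_erase (he.2 j hje))

section EdgeWeight

variable {n : ℕ} {i j : Fin n} {z w y : ℝ}

theorem edgeWeight_pair : edgeWeight i j z w s(i, j) = z * w := by
  simp [edgeWeight]

theorem edgeWeight_left (hij : i ≠ j) {v : Fin n} (hv : v ≠ j) :
    edgeWeight i j z w s(i, v) = z := by
  simp [edgeWeight, hv.symm, hij.symm]

theorem edgeWeight_right (hij : i ≠ j) {v : Fin n} (hv : v ≠ i) :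
    edgeWeight i j z w s(j, v) = w := by
  simp [edgeWeight, hv.symm, hij]

theorem edgeWeight_off {e : Sym2 (Fin n)} (hi : i ∉ e) (hj : j ∉ e) :
    edgeWeight i j z w e = 1 := by
  simp [edgeWeight, hi, hj]

theorem prod_bernPgf_edgeWeight (V : Finset (Fin n)) (hij : i ≠ j) :
    ∏ e, (if IsPairIn V e then y * edgeWeight i j z w e + (1 - y) * 1 else 1) =
      1 + (if i ∈ V then 1 else 0) * (bernPgf y z ^ (V.card - 1) - 1) +
        (if j ∈ V then 1 else 0) * (bernPgf y w ^ (V.card - 1) - 1) +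
        (if i ∈ V ∧ j ∈ V then 1 else 0) *
          (bernPgf y (z * w) * (bernPgf y z ^ (V.card - 2) * bernPgf y w ^ (V.card - 2)) -
            bernPgf y z ^ (V.card - 1) - bernPgf y w ^ (V.card - 1) + 1) := by
  have hb : ∀ u : ℝ, y * u + (1 - y) * 1 = bernPgf y u := fun u => by unfold bernPgf; ring
  simp only [hb]
  rw [prod_pairs V hij fun e hi hj => by rw [edgeWeight_off hi hj, bernPgf_one]]
  have h2 : ∏ v ∈ (V.erase i).erase j, bernPgf y (edgeWeight i j z w s(j, v)) =
      bernPgf y w ^ ((V.erase i).erase j).card := by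
    rw [← Finset.prod_const]
    refine Finset.prod_congr rfl fun v hv => ?_
    rw [edgeWeight_right hij (Finset.mem_erase.1 (Finset.mem_of_mem_erase hv)).1]
  have h1 : ∏ v ∈ (V.erase i).erase j, bernPgf y (edgeWeight i j z w s(i, v)) =
      bernPgf y z ^ ((V.erase i).erase j).card := by
    rw [← Finset.prod_const]
    refine Finset.prod_congr rfl fun v hv => ?_
    rw [edgeWeight_left hij (Finset.mem_erase.1 hv).1]
  rw [h2]
  by_cases hi : i ∈ V <;> by_cases hj : j ∈ V
  · have hj' : j ∈ V.erase i := Finset.mem_erase.2 ⟨hij.symm, hj⟩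
    rw [if_pos hi, ← Finset.mul_prod_erase _ _ hj', h1, edgeWeight_pair,
      Finset.card_erase_of_mem hj', Finset.card_erase_of_mem hi]
    simp only [hi, hj, if_true, and_self, one_mul, Nat.sub_sub]
    ring
  · have hj' : j ∉ V.erase i := fun h => hj (Finset.mem_of_mem_erase h)
    rw [Finset.erase_eq_of_notMem hj', Finset.card_erase_of_mem hi] at h1
    rw [if_pos hi, h1]
    simp [hi, hj]
  · have hj' : j ∈ V.erase i := Finset.mem_erase.2 ⟨hij.symm, hj⟩
    rw [Finset.card_erase_of_mem hj', Finset.erase_eq_of_notMem hi]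
    simp [hi, hj]
  · simp [hi, hj]

theorem prod_adj_edgeWeight (V : Finset (Fin n)) (hij : i ≠ j) :
    ∏ e, (if IsPairIn V e then y * edgeWeight i j z w e +
        (1 - y) * (if e = s(i, j) then 0 else 1) else if e = s(i, j) then 0 else 1) =
      (if i ∈ V ∧ j ∈ V then 1 else 0) *
        (y * z * w * (bernPgf y z ^ (V.card - 2) * bernPgf y w ^ (V.card - 2))) := by
  by_cases h : i ∈ V ∧ j ∈ V
  · obtain ⟨hi, hj⟩ := h
    have hp : IsPairIn V s(i, j) := by
      refine ⟨by simpa using hij, fun v hv => ?_⟩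
      rcases Sym2.mem_iff.1 hv with rfl | rfl
      exacts [hi, hj]
    have e1 : ∀ e, (if IsPairIn V e then y * edgeWeight i j z w e +
        (1 - y) * (if e = s(i, j) then 0 else 1) else if e = s(i, j) then 0 else 1) =
        if IsPairIn V e then y * edgeWeight i j z w e +
        (1 - y) * (if e = s(i, j) then 0 else 1) else 1 := fun e => by
      by_cases he : e = s(i, j)
      · subst he; simp [hp]
      · simp [he]
    have hj' : j ∈ V.erase i := Finset.mem_erase.2 ⟨hij.symm, hj⟩
    simp only [e1]
    rw [prod_pairs V hij, if_pos hi, if_pos hj, ← Finset.mul_prod_erase _ _ hj']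
    · have h1 : ∏ v ∈ (V.erase i).erase j, (y * edgeWeight i j z w s(i, v) +
          (1 - y) * (if s(i, v) = s(i, j) then 0 else 1)) = bernPgf y z ^ (V.card - 2) := by
        rw [show V.card - 2 = ((V.erase i).erase j).card by
          rw [Finset.card_erase_of_mem hj', Finset.card_erase_of_mem hi, Nat.sub_sub],
          ← Finset.prod_const]
        refine Finset.prod_congr rfl fun v hv => ?_
        have hvj := (Finset.mem_erase.1 hv).1
        rw [edgeWeight_left hij hvj, if_neg fun h => hvj (Sym2.congr_right.1 h)]
        unfold bernPgf; ring
      have h2 : ∏ v ∈ (V.erase i).erase j, (y * edgeWeight i j z w s(j, v) +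
          (1 - y) * (if s(j, v) = s(i, j) then 0 else 1)) = bernPgf y w ^ (V.card - 2) := by
        rw [show V.card - 2 = ((V.erase i).erase j).card by
          rw [Finset.card_erase_of_mem hj', Finset.card_erase_of_mem hi, Nat.sub_sub],
          ← Finset.prod_const]
        refine Finset.prod_congr rfl fun v hv => ?_
        have hvi := (Finset.mem_erase.1 (Finset.mem_of_mem_erase hv)).1
        rw [edgeWeight_right hij hvi, if_neg fun h => hvi (by
          rw [Sym2.eq_swap] at h; exact Sym2.congr_left.1 h)]
        unfold bernPgf; ring
      rw [h1, h2, edgeWeight_pair]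
      simp only [hi, hj, if_true, and_self]
      ring
    · intro e hie hje
      rw [edgeWeight_off hie hje, if_neg fun h => hie (by simp [h])]
      ring
  · rw [if_neg h, zero_mul]
    refine Finset.prod_eq_zero (Finset.mem_univ s(i, j)) ?_
    have hp : ¬ IsPairIn V s(i, j) := fun hp => h ⟨hp.2 i (by simp), hp.2 j (by simp)⟩
    simp [hp]

end EdgeWeight

theorem sum_powersetCard_subset {n x : ℕ} (hx : x ≤ n) (T : Finset (Fin n)) :
    ((n.choose x : ℝ))⁻¹ * ∑ V ∈ Finset.powersetCard x Finset.univ,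
      (if T ⊆ V then (1 : ℝ) else 0) = (x.descFactorial T.card : ℝ) / n.descFactorial T.card := by
  have hT : T.card ≤ n := by simpa using Finset.card_le_univ T
  have hn : (0 : ℝ) < n.choose x := by exact_mod_cast Nat.choose_pos hx
  have hn' : (0 : ℝ) < n.choose T.card := by exact_mod_cast Nat.choose_pos hT
  have hf : (0 : ℝ) < T.card.factorial := by positivity
  rw [Nat.descFactorial_eq_factorial_mul_choose, Nat.descFactorial_eq_factorial_mul_choose,
    Nat.cast_mul, Nat.cast_mul, mul_div_mul_left _ _ hf.ne', Finset.sum_boole]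
  rcases le_or_gt T.card x with h | h
  · rw [Finset.card_filter_powersetCard_subset _ _ _ (Finset.subset_univ T) h,
      Finset.card_univ, Fintype.card_fin]
    have := Nat.choose_mul (n := n) h
    rw [mul_comm (n.choose T.card)] at this
    field_simp
    exact_mod_cast this.symm
  · rw [Nat.choose_eq_zero_of_lt h, Finset.filter_false_of_mem]
    · simp
    · intro V hV hTV
      have := Finset.card_le_card hTV
      rw [(Finset.mem_powersetCard.1 hV).2] at this
      omega

section LayerMoments

variable {n : ℕ} {Q : Measure (ℕ × ℝ)} [IsProbabilityMeasure Q]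

/-- The integrand of second order in the joint degree generating function of a layer. -/
def layerPgfRest (z w : ℝ) (p : ℕ × ℝ) : ℝ :=
  bernPgf p.2 (z * w) * (bernPgf p.2 z ^ (p.1 - 2) * bernPgf p.2 w ^ (p.1 - 2)) -
    bernPgf p.2 z ^ (p.1 - 1) - bernPgf p.2 w ^ (p.1 - 1) + 1

theorem continuous_layerPgfRest (z w : ℝ) (a : ℕ) :
    Continuous fun y => layerPgfRest z w (a, y) := by
  unfold layerPgfRest bernPgf; dsimp only; fun_prop

theorem abs_layerPgfRest_le {z w : ℝ} (hz : z ∈ Set.Icc (0 : ℝ) 1) (hw : w ∈ Set.Icc (0 : ℝ) 1)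
    {p : ℕ × ℝ} (hp : p.2 ∈ Set.Icc (0 : ℝ) 1) : |layerPgfRest z w p| ≤ 2 := by
  have h1 := bernPgf_mem hp hz
  have h2 := bernPgf_mem hp hw
  have h3 := bernPgf_mem hp (unitInterval.mul_mem hz hw)
  have h4 := unitInterval.mul_mem h3 (unitInterval.mul_mem
    (Set.mem_Icc.2 ⟨pow_nonneg h1.1 (p.1 - 2), pow_le_one₀ h1.1 h1.2⟩)
    (Set.mem_Icc.2 ⟨pow_nonneg h2.1 (p.1 - 2), pow_le_one₀ h2.1 h2.2⟩))
  have h5 := pow_nonneg h1.1 (p.1 - 1)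
  have h6 := pow_nonneg h2.1 (p.1 - 1)
  have h7 : bernPgf p.2 z ^ (p.1 - 1) ≤ 1 := pow_le_one₀ h1.1 h1.2
  have h8 : bernPgf p.2 w ^ (p.1 - 1) ≤ 1 := pow_le_one₀ h2.1 h2.2
  unfold layerPgfRest
  rw [abs_le]
  constructor <;> linarith [h4.1, h4.2]

/-- The joint degree generating function of two nodes in a layer. -/
def layerPgf (n : ℕ) (Q : Measure (ℕ × ℝ)) (z w : ℝ) : ℝ :=
  1 + ((∫ p, (p.1 : ℝ) * (bernPgf p.2 z ^ (p.1 - 1) - 1) ∂Q) / n +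
    (∫ p, (p.1 : ℝ) * (bernPgf p.2 w ^ (p.1 - 1) - 1) ∂Q) / n +
    (∫ p, (p.1.descFactorial 2 : ℝ) * layerPgfRest z w p ∂Q) / n.descFactorial 2)

theorem integral_pow_layerDeg (hQ : ∀ᵐ p ∂Q, p.1 ≤ n ∧ p.2 ∈ Set.Icc (0 : ℝ) 1)
    {i j : Fin n} (hij : i ≠ j) (z w : ℝ) :
    ∫ L, z ^ layerDeg L i * w ^ layerDeg L j ∂layerMeasure n Q = layerPgf n Q z w := by
  have h := integral_layer_prod hQ (fun _ => 1) (edgeWeight i j z w) (fun _ => 1)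
  simp only [one_mul, ← pow_layerDeg] at h
  have hc : ∀ z a, Continuous fun y => ((a : ℕ) : ℝ) * (bernPgf y z ^ (a - 1) - 1) := fun z a => by
    unfold bernPgf; fun_prop
  have hc' : ∀ a : ℕ, Continuous fun y => (a.descFactorial 2 : ℝ) * layerPgfRest z w (a, y) :=
    fun a => continuous_const.mul (continuous_layerPgfRest z w a)
  have i1 := fun z => integrable_of_bounded_support (Q := Q) hQ
    (f := fun p => (p.1 : ℝ) * (bernPgf p.2 z ^ (p.1 - 1) - 1)) (hc z)
  have i2 := integrable_of_bounded_support (Q := Q) hQ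
    (f := fun p => (p.1.descFactorial 2 : ℝ) * layerPgfRest z w p) hc'
  have h1 : layerPgf n Q z w = ∫ p, (1 + ((p.1 : ℝ) * (bernPgf p.2 z ^ (p.1 - 1) - 1) / n +
      (p.1 : ℝ) * (bernPgf p.2 w ^ (p.1 - 1) - 1) / n +
      (p.1.descFactorial 2 : ℝ) * layerPgfRest z w p / n.descFactorial 2)) ∂Q := by
    have j1 := fun z => (i1 z).div_const (n : ℝ)
    have j2 := i2.div_const (n.descFactorial 2 : ℝ)
    have j3 : Integrable (fun p : ℕ × ℝ => (p.1 : ℝ) * (bernPgf p.2 z ^ (p.1 - 1) - 1) / n +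
      (p.1 : ℝ) * (bernPgf p.2 w ^ (p.1 - 1) - 1) / n) Q := (j1 z).add (j1 w)
    have j4 : Integrable (fun p : ℕ × ℝ => ((p.1 : ℝ) * (bernPgf p.2 z ^ (p.1 - 1) - 1) / n +
      (p.1 : ℝ) * (bernPgf p.2 w ^ (p.1 - 1) - 1) / n) +
      (p.1.descFactorial 2 : ℝ) * layerPgfRest z w p / n.descFactorial 2) Q := j3.add j2
    rw [integral_add (integrable_const _) j4, integral_add j3 j2,
      integral_add (j1 z) (j1 w), integral_div, integral_div, integral_div]
    simp [layerPgf]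
  rw [h, h1]
  refine integral_congr_ae (hQ.mono fun p hp => ?_)
  have e0 := sum_powersetCard_subset hp.1 (∅ : Finset (Fin n))
  have e1 := fun k => sum_powersetCard_subset hp.1 ({k} : Finset (Fin n))
  have e2 := sum_powersetCard_subset hp.1 ({i, j} : Finset (Fin n))
  simp only [Finset.singleton_subset_iff, Finset.card_singleton, Nat.descFactorial_one] at e1
  simp only [Finset.insert_subset_iff, Finset.singleton_subset_iff, Finset.card_pair hij] at e2
  simp only [Finset.empty_subset, if_true, Finset.card_empty, Nat.descFactorial_zero,
    Nat.cast_one, div_one] at e0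
  have hs : ∀ V ∈ Finset.powersetCard p.1 (Finset.univ : Finset (Fin n)),
      ∏ e, (if IsPairIn V e then p.2 * edgeWeight i j z w e + (1 - p.2) * 1 else 1) =
      1 + (if i ∈ V then 1 else 0) * (bernPgf p.2 z ^ (p.1 - 1) - 1) +
        (if j ∈ V then 1 else 0) * (bernPgf p.2 w ^ (p.1 - 1) - 1) +
        (if i ∈ V ∧ j ∈ V then 1 else 0) * layerPgfRest z w p := fun V hV => by
    rw [prod_bernPgf_edgeWeight V hij, (Finset.mem_powersetCard.1 hV).2]
    rfl
  dsimp only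
  rw [Finset.sum_congr rfl hs]
  simp only [Finset.sum_add_distrib, ← Finset.sum_mul, mul_add, ← mul_assoc]
  rw [e0, e1 i, e1 j, e2]
  ring

theorem integral_layer_adj (hQ : ∀ᵐ p ∂Q, p.1 ≤ n ∧ p.2 ∈ Set.Icc (0 : ℝ) 1)
    {i j : Fin n} (hij : i ≠ j) (r : ℕ → ℝ) (z w : ℝ) :
    ∫ L, r L.2.1.card * ((if s(i, j) ∈ layerEdges L then 1 else 0) *
        (z ^ layerDeg L i * w ^ layerDeg L j)) ∂layerMeasure n Q =
      z * w / n.descFactorial 2 * ∫ p, r p.1 * ((p.1.descFactorial 2 : ℝ) * p.2 *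
        (bernPgf p.2 z ^ (p.1 - 2) * bernPgf p.2 w ^ (p.1 - 2))) ∂Q := by
  have h := integral_layer_prod hQ (fun V => r V.card) (edgeWeight i j z w)
    (fun e => if e = s(i, j) then 0 else 1)
  have hL : ∀ L : Layer n, (∏ e, if e ∈ layerEdges L then edgeWeight i j z w e else
      if e = s(i, j) then 0 else 1) = (if s(i, j) ∈ layerEdges L then 1 else 0) *
        (z ^ layerDeg L i * w ^ layerDeg L j) := fun L => by
    rw [pow_layerDeg]
    by_cases hm : s(i, j) ∈ layerEdges L
    · rw [if_pos hm, one_mul]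
      refine Finset.prod_congr rfl fun e _ => ?_
      by_cases he : e = s(i, j)
      · subst he; simp [hm]
      · simp [he]
    · rw [if_neg hm, zero_mul]
      exact Finset.prod_eq_zero (Finset.mem_univ s(i, j)) (by simp [hm])
  simp only [hL] at h
  rw [h, ← integral_const_mul]
  refine integral_congr_ae (hQ.mono fun p hp => ?_)
  have e2 := sum_powersetCard_subset hp.1 ({i, j} : Finset (Fin n))
  simp only [Finset.insert_subset_iff, Finset.singleton_subset_iff, Finset.card_pair hij] at e2
  have hs : ∀ V ∈ Finset.powersetCard p.1 (Finset.univ : Finset (Fin n)),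
      r V.card * ∏ e, (if IsPairIn V e then p.2 * edgeWeight i j z w e +
        (1 - p.2) * (if e = s(i, j) then 0 else 1) else if e = s(i, j) then 0 else 1) =
      (if i ∈ V ∧ j ∈ V then 1 else 0) * (r p.1 *
        (p.2 * z * w * (bernPgf p.2 z ^ (p.1 - 2) * bernPgf p.2 w ^ (p.1 - 2)))) := fun V hV => by
    rw [prod_adj_edgeWeight V hij, (Finset.mem_powersetCard.1 hV).2]
    ring
  dsimp only
  rw [Finset.sum_congr rfl hs, ← Finset.sum_mul, ← mul_assoc, e2]
  ring

end LayerMoments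

/-! ### Asymptotics of the generating functions of a layer -/

section Asymptotics

variable {Pn : ℕ → ProbabilityMeasure (ℕ × ℝ)} {P : ProbabilityMeasure (ℕ × ℝ)} {z w mu : ℝ}
  {m : ℕ → ℕ}

theorem mom_one_zero (Q : Measure (ℕ × ℝ)) : mom Q 1 0 = ∫ p, (p.1 : ℝ) ∂Q := by
  simp [mom]

theorem mom_two_one (Q : Measure (ℕ × ℝ)) :
    mom Q 2 1 = ∫ p, (p.1.descFactorial 2 : ℝ) * p.2 ∂Q := by
  simp [mom]

theorem tendsto_first_order_term (hweak : Tendsto Pn atTop (𝓝 P))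
    (hPn : ∀ n, ∀ᵐ p ∂(Pn n : Measure (ℕ × ℝ)), p.1 ≤ n ∧ p.2 ∈ Set.Icc (0 : ℝ) 1)
    (hP : ∀ᵐ p ∂(P : Measure (ℕ × ℝ)), p.2 ∈ Set.Icc (0 : ℝ) 1)
    (hint10 : Integrable (fun p : ℕ × ℝ => (p.1 : ℝ)) (P : Measure (ℕ × ℝ)))
    (h10pos : 0 < mom (P : Measure (ℕ × ℝ)) 1 0)
    (h10 : Tendsto (fun n : ℕ => mom (Pn n : Measure (ℕ × ℝ)) 1 0) atTop
      (𝓝 (mom (P : Measure (ℕ × ℝ)) 1 0)))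
    (hz : z ∈ Set.Icc (0 : ℝ) 1) :
    Tendsto (fun n => ∫ p, (p.1 : ℝ) * (bernPgf p.2 z ^ (p.1 - 1) - 1)
      ∂(Pn n : Measure (ℕ × ℝ))) atTop
      (𝓝 (mom (P : Measure (ℕ × ℝ)) 1 0 * (gPgf (P : Measure (ℕ × ℝ)) z - 1))) := by
  simp only [mom_one_zero] at h10
  have hb : ∀ a : ℕ, ∀ y ∈ Set.Icc (0 : ℝ) 1,
      0 ≤ bernPgf y z ^ (a - 1) ∧ bernPgf y z ^ (a - 1) ≤ 1 := fun a y hy =>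
    ⟨pow_nonneg (bernPgf_mem hy hz).1 _,
      pow_le_one₀ (bernPgf_mem hy hz).1 (bernPgf_mem hy hz).2⟩
  have h := tendsto_integral_of_weak_of_le hweak hPn hP
    (f := fun p => (p.1 : ℝ) * (bernPgf p.2 z ^ (p.1 - 1) - 1)) (h := fun p => (p.1 : ℝ))
    (fun a => by unfold bernPgf; dsimp only; fun_prop) (fun a => by fun_prop) hint10 h10
    (fun a y hy => by
      dsimp only
      rw [abs_mul, Nat.abs_cast]
      refine mul_le_of_le_one_right (Nat.cast_nonneg a) ?_
      rw [abs_le]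
      constructor <;> linarith [hb a y hy])
  convert h using 2
  have hi : Integrable (fun p : ℕ × ℝ => (p.1 : ℝ) * bernPgf p.2 z ^ (p.1 - 1))
      (P : Measure (ℕ × ℝ)) := by
    refine hint10.mono' (measurable_of_continuous_snd fun a => by
      unfold bernPgf; dsimp only; fun_prop).aestronglyMeasurable (hP.mono fun p hp => ?_)
    rw [Real.norm_of_nonneg (mul_nonneg (Nat.cast_nonneg _) (hb p.1 p.2 hp).1)]
    exact mul_le_of_le_one_right (Nat.cast_nonneg _) (hb p.1 p.2 hp).2
  simp only [mul_sub, mul_one]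
  rw [integral_sub hi hint10, ← mom_one_zero, gPgf, mul_div_cancel₀ _ h10pos.ne']

theorem abs_descFactorial_ratio_le {a n : ℕ} (hn : 2 ≤ n) {θ : ℝ} (hθ : |θ| ≤ 2) :
    |(n : ℝ) * ((a.descFactorial 2 : ℝ) * θ / n.descFactorial 2)| ≤
      4 * ((a : ℝ) * (a / n)) := by
  have hn' : (2 : ℝ) ≤ n := by exact_mod_cast hn
  have ha : 0 ≤ (a.descFactorial 2 : ℝ) := Nat.cast_nonneg _
  have ha2 : (a.descFactorial 2 : ℝ) ≤ a * a := by
    rw [Nat.cast_descFactorial_two]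
    nlinarith [(Nat.cast_nonneg a : (0 : ℝ) ≤ a)]
  have e : (n : ℝ) * ((a.descFactorial 2 : ℝ) * θ / n.descFactorial 2) =
      (a.descFactorial 2 : ℝ) * θ / (n - 1) := by
    rw [Nat.cast_descFactorial_two ℝ n]
    have : (n : ℝ) - 1 ≠ 0 := by linarith
    field_simp
  rw [e, abs_div, abs_mul, abs_of_nonneg ha, abs_of_pos (show (0 : ℝ) < n - 1 by linarith),
    div_le_iff₀ (by linarith)]
  calc (a.descFactorial 2 : ℝ) * |θ| ≤ (a * a) * 2 := by gcongr
    _ ≤ (a * a) * (4 * ((n - 1) / n)) := by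
        gcongr
        rw [← mul_div_assoc, le_div_iff₀ (by linarith)]
        linarith
    _ = 4 * ((a : ℝ) * (a / n)) * (n - 1) := by ring

theorem tendsto_second_order_term (hweak : Tendsto Pn atTop (𝓝 P))
    (hPn : ∀ n, ∀ᵐ p ∂(Pn n : Measure (ℕ × ℝ)), p.1 ≤ n ∧ p.2 ∈ Set.Icc (0 : ℝ) 1)
    (hP : ∀ᵐ p ∂(P : Measure (ℕ × ℝ)), p.2 ∈ Set.Icc (0 : ℝ) 1)
    (hint10 : Integrable (fun p : ℕ × ℝ => (p.1 : ℝ)) (P : Measure (ℕ × ℝ)))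
    (h10 : Tendsto (fun n : ℕ => mom (Pn n : Measure (ℕ × ℝ)) 1 0) atTop
      (𝓝 (mom (P : Measure (ℕ × ℝ)) 1 0)))
    (hz : z ∈ Set.Icc (0 : ℝ) 1) (hw : w ∈ Set.Icc (0 : ℝ) 1) :
    Tendsto (fun n : ℕ => (n : ℝ) * ((∫ p, (p.1.descFactorial 2 : ℝ) * layerPgfRest z w p
      ∂(Pn n : Measure (ℕ × ℝ))) / n.descFactorial 2)) atTop (𝓝 0) := by
  simp only [mom_one_zero] at h10
  have h := (tendsto_integral_mul_div_zero hweak hPn hP (h := fun p => (p.1 : ℝ))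
    (fun a => by fun_prop) hint10 h10 (fun a y _ => Nat.cast_nonneg a)).const_mul 4
  rw [mul_zero] at h
  refine squeeze_zero_norm' (eventually_atTop.2 ⟨2, fun n hn => ?_⟩) h
  rw [← integral_div, ← integral_const_mul, ← integral_const_mul]
  refine norm_integral_le_of_norm_le ?_ ((hPn n).mono fun p hp => ?_)
  · refine integrable_of_bounded_support (hPn n) fun a => ?_
    fun_prop
  · exact abs_descFactorial_ratio_le hn (abs_layerPgfRest_le hz hw hp.2)

theorem tendsto_layerPgf (hweak : Tendsto Pn atTop (𝓝 P))
    (hPn : ∀ n, ∀ᵐ p ∂(Pn n : Measure (ℕ × ℝ)), p.1 ≤ n ∧ p.2 ∈ Set.Icc (0 : ℝ) 1)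
    (hP : ∀ᵐ p ∂(P : Measure (ℕ × ℝ)), p.2 ∈ Set.Icc (0 : ℝ) 1)
    (hint10 : Integrable (fun p : ℕ × ℝ => (p.1 : ℝ)) (P : Measure (ℕ × ℝ)))
    (h10pos : 0 < mom (P : Measure (ℕ × ℝ)) 1 0)
    (h10 : Tendsto (fun n : ℕ => mom (Pn n : Measure (ℕ × ℝ)) 1 0) atTop
      (𝓝 (mom (P : Measure (ℕ × ℝ)) 1 0)))
    (hz : z ∈ Set.Icc (0 : ℝ) 1) (hw : w ∈ Set.Icc (0 : ℝ) 1) :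
    Tendsto (fun n : ℕ => (n : ℝ) * (layerPgf n (Pn n : Measure (ℕ × ℝ)) z w - 1)) atTop
      (𝓝 (mom (P : Measure (ℕ × ℝ)) 1 0 * (gPgf (P : Measure (ℕ × ℝ)) z - 1) +
        mom (P : Measure (ℕ × ℝ)) 1 0 * (gPgf (P : Measure (ℕ × ℝ)) w - 1))) := by
  have h := ((tendsto_first_order_term hweak hPn hP hint10 h10pos h10 hz).add
    (tendsto_first_order_term hweak hPn hP hint10 h10pos h10 hw)).add
    (tendsto_second_order_term hweak hPn hP hint10 h10 hz hw)
  rw [add_zero] at h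
  refine h.congr' (eventually_atTop.2 ⟨1, fun n hn => ?_⟩)
  have hn0 : (n : ℝ) ≠ 0 := by positivity
  dsimp only
  rw [layerPgf, add_sub_cancel_left, mul_add, mul_add, mul_div_cancel₀ _ hn0,
    mul_div_cancel₀ _ hn0]

theorem layerPgf_nonneg {n : ℕ} (hn : 2 ≤ n) {Q : Measure (ℕ × ℝ)} [IsProbabilityMeasure Q]
    (hQ : ∀ᵐ p ∂Q, p.1 ≤ n ∧ p.2 ∈ Set.Icc (0 : ℝ) 1) (hz : 0 ≤ z) (hw : 0 ≤ w) :
    0 ≤ layerPgf n Q z w := by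
  have hij : (⟨0, by omega⟩ : Fin n) ≠ ⟨1, by omega⟩ := by simp
  rw [← integral_pow_layerDeg hQ hij]
  exact integral_nonneg fun L => by positivity

theorem tendsto_pow_of_tendsto_mul_sub_one {a : ℕ → ℝ} {c : ℝ} {k : ℕ → ℕ}
    (ha0 : ∀ᶠ n in atTop, 0 ≤ a n) (ha : Tendsto (fun n : ℕ => (n : ℝ) * (a n - 1)) atTop (𝓝 c))
    (hk : Tendsto (fun n : ℕ => (k n : ℝ) / n) atTop (𝓝 mu)) :
    Tendsto (fun n => a n ^ k n) atTop (𝓝 (Real.exp (mu * c))) := by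
  have h1 : Tendsto (fun n => a n ^ n) atTop (𝓝 (Real.exp c)) := by
    simpa using Real.tendsto_one_add_pow_exp_of_tendsto ha
  have h2 := h1.rpow hk (Or.inl (Real.exp_pos c).ne')
  rw [← Real.exp_mul, mul_comm] at h2
  refine h2.congr' ((ha0.and (eventually_ge_atTop 1)).mono fun n hn => ?_)
  have hn0 : (n : ℝ) ≠ 0 := by have := hn.2; positivity
  rw [← Real.rpow_natCast, ← Real.rpow_mul hn.1, mul_div_cancel₀ _ hn0, Real.rpow_natCast]

theorem tendsto_sub_one_div (hratio : Tendsto (fun n : ℕ => (m n : ℝ) / n) atTop (𝓝 mu)) :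
    Tendsto (fun n : ℕ => ((m n - 1 : ℕ) : ℝ) / n) atTop (𝓝 mu) := by
  have h1 := hratio.sub (tendsto_const_div_atTop_nhds_zero_nat (1 : ℝ))
  rw [sub_zero] at h1
  refine tendsto_of_tendsto_of_tendsto_of_le_of_le h1 hratio (fun n => ?_) fun n => ?_
  · dsimp only
    rw [← sub_div]
    gcongr
    rw [sub_le_iff_le_add]
    exact_mod_cast (by omega : m n ≤ m n - 1 + 1)
  · dsimp only
    gcongr
    omega

theorem tendsto_mul_div_descFactorial
    (hratio : Tendsto (fun n : ℕ => (m n : ℝ) / n) atTop (𝓝 mu)) :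
    Tendsto (fun n : ℕ => (n : ℝ) * m n / n.descFactorial 2) atTop (𝓝 mu) := by
  have h1 : Tendsto (fun n : ℕ => (n : ℝ) / ((n : ℝ) + (-1))) atTop (𝓝 1) :=
    tendsto_natCast_div_add_atTop (-1 : ℝ)
  have h := hratio.mul h1
  rw [mul_one] at h
  refine h.congr' (eventually_atTop.2 ⟨2, fun n hn => ?_⟩)
  have hn' : (2 : ℝ) ≤ n := by exact_mod_cast hn
  have h3 : (n : ℝ) - 1 ≠ 0 := by linarith
  dsimp only
  rw [Nat.cast_descFactorial_two, ← sub_eq_add_neg]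
  field_simp

theorem tendsto_adj_term (hweak : Tendsto Pn atTop (𝓝 P))
    (hPn : ∀ n, ∀ᵐ p ∂(Pn n : Measure (ℕ × ℝ)), p.1 ≤ n ∧ p.2 ∈ Set.Icc (0 : ℝ) 1)
    (hP : ∀ᵐ p ∂(P : Measure (ℕ × ℝ)), p.2 ∈ Set.Icc (0 : ℝ) 1)
    (hint21 : Integrable (fun p : ℕ × ℝ => (p.1.descFactorial 2 : ℝ) * p.2)
      (P : Measure (ℕ × ℝ)))
    (h21pos : 0 < mom (P : Measure (ℕ × ℝ)) 2 1)
    (h21 : Tendsto (fun n : ℕ => mom (Pn n : Measure (ℕ × ℝ)) 2 1) atTop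
      (𝓝 (mom (P : Measure (ℕ × ℝ)) 2 1)))
    (hz : z ∈ Set.Icc (0 : ℝ) 1) (hw : w ∈ Set.Icc (0 : ℝ) 1) :
    Tendsto (fun n => ∫ p, (p.1.descFactorial 2 : ℝ) * p.2 *
      (bernPgf p.2 z ^ (p.1 - 2) * bernPgf p.2 w ^ (p.1 - 2)) ∂(Pn n : Measure (ℕ × ℝ))) atTop
      (𝓝 (mom (P : Measure (ℕ × ℝ)) 2 1 * f2pPgf (P : Measure (ℕ × ℝ)) z w)) := by
  simp only [mom_two_one] at h21
  rw [f2pPgf, mul_div_cancel₀ _ h21pos.ne']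
  refine tendsto_integral_of_weak_of_le hweak hPn hP
    (h := fun p => (p.1.descFactorial 2 : ℝ) * p.2)
    (fun a => by unfold bernPgf; dsimp only; fun_prop) (fun a => by fun_prop) hint21 h21
    (fun a y hy => ?_)
  have h1 := bernPgf_mem hy hz
  have h2 := bernPgf_mem hy hw
  have h3 := unitInterval.mul_mem
    (Set.mem_Icc.2 ⟨pow_nonneg h1.1 (a - 2), pow_le_one₀ h1.1 h1.2⟩)
    (Set.mem_Icc.2 ⟨pow_nonneg h2.1 (a - 2), pow_le_one₀ h2.1 h2.2⟩)
  have h4 : 0 ≤ (a.descFactorial 2 : ℝ) * y := mul_nonneg (Nat.cast_nonneg _) hy.1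
  dsimp only
  rw [abs_of_nonneg (mul_nonneg h4 h3.1)]
  exact mul_le_of_le_one_right h4 h3.2

theorem tendsto_adj_remainder (hweak : Tendsto Pn atTop (𝓝 P))
    (hPn : ∀ n, ∀ᵐ p ∂(Pn n : Measure (ℕ × ℝ)), p.1 ≤ n ∧ p.2 ∈ Set.Icc (0 : ℝ) 1)
    (hP : ∀ᵐ p ∂(P : Measure (ℕ × ℝ)), p.2 ∈ Set.Icc (0 : ℝ) 1)
    (hint21 : Integrable (fun p : ℕ × ℝ => (p.1.descFactorial 2 : ℝ) * p.2)
      (P : Measure (ℕ × ℝ)))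
    (h21 : Tendsto (fun n : ℕ => mom (Pn n : Measure (ℕ × ℝ)) 2 1) atTop
      (𝓝 (mom (P : Measure (ℕ × ℝ)) 2 1))) :
    Tendsto (fun n : ℕ => (∫ p, (p.1 : ℝ) * ((p.1.descFactorial 2 : ℝ) * p.2)
      ∂(Pn n : Measure (ℕ × ℝ))) / n) atTop (𝓝 0) := by
  simp only [mom_two_one] at h21
  refine (tendsto_integral_mul_div_zero hweak hPn hP
    (h := fun p => (p.1.descFactorial 2 : ℝ) * p.2) (fun a => by fun_prop) hint21 h21
    (fun a y hy => mul_nonneg (Nat.cast_nonneg _) hy.1)).congr fun n => ?_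
  rw [← integral_div]
  congr 1 with p
  ring

end Asymptotics

/-! ### Overlapping layers in the superposition graph -/

/-- The degree of node `i` in the superposition graph. -/
def graphDeg {n m : ℕ} (ω : Fin m → Layer n) (i : Fin n) : ℕ :=
  ((graphEdges ω).filter (i ∈ ·)).card

theorem mem_graphEdges {n m : ℕ} {ω : Fin m → Layer n} {e : Sym2 (Fin n)} :
    e ∈ graphEdges ω ↔ ∃ k, e ∈ layerEdges (ω k) := by
  simp [graphEdges]

/-- The indicator of an edge of a layer. -/
def edgeInd {n : ℕ} (e : Sym2 (Fin n)) (L : Layer n) : ℝ := if e ∈ layerEdges L then 1 else 0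

theorem edgeInd_nonneg {n : ℕ} (e : Sym2 (Fin n)) (L : Layer n) : 0 ≤ edgeInd e L := by
  unfold edgeInd; split_ifs <;> norm_num

/-- The node pairs that contain `i` or `j`. -/
def incidentPairs {n : ℕ} (i j : Fin n) : Finset (Sym2 (Fin n)) :=
  Finset.univ.filter fun e => ¬ e.IsDiag ∧ (i ∈ e ∨ j ∈ e)

theorem mem_incidentPairs {n : ℕ} {i j : Fin n} {e : Sym2 (Fin n)} :
    e ∈ incidentPairs i j ↔ ¬ e.IsDiag ∧ (i ∈ e ∨ j ∈ e) := by
  simp [incidentPairs]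

/-- Triples of two distinct layers and a node pair that contains `i` or `j`. -/
def layerOverlaps {n : ℕ} (m : ℕ) (i j : Fin n) : Finset ((Fin m × Fin m) × Sym2 (Fin n)) :=
  (Finset.univ ×ˢ incidentPairs i j).filter fun t => t.1.1 ≠ t.1.2

section Pointwise

variable {n m : ℕ} {i j : Fin n} {z w : ℝ}

theorem not_isDiag_of_mem_layerEdges {L : Layer n} {e : Sym2 (Fin n)} (h : e ∈ layerEdges L) :
    ¬ e.IsDiag :=
  (mem_layerEdges.1 h).2.1

theorem graphDeg_eq_sum {ω : Fin m → Layer n}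
    (h : ∀ k l, k ≠ l → ∀ e, i ∈ e → e ∈ layerEdges (ω k) → e ∉ layerEdges (ω l)) :
    graphDeg ω i = ∑ k, layerDeg (ω k) i := by
  unfold graphDeg layerDeg graphEdges
  rw [Finset.filter_biUnion, Finset.card_biUnion]
  intro k _ l _ hkl
  refine Finset.disjoint_left.2 fun e hk hl => ?_
  rw [Finset.mem_filter] at hk hl
  exact h k l hkl e hk.2 hk.1 hl.1

theorem abs_pgf_sub_le (hz : z ∈ Set.Icc (0 : ℝ) 1) (hw : w ∈ Set.Icc (0 : ℝ) 1)
    (ω : Fin m → Layer n) :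
    |(if s(i, j) ∈ graphEdges ω then 1 else 0) * (z ^ graphDeg ω i * w ^ graphDeg ω j) -
      ∑ k, edgeInd s(i, j) (ω k) * ∏ l, (z ^ layerDeg (ω l) i * w ^ layerDeg (ω l) j)| ≤
    ∑ k, ∑ t ∈ layerOverlaps m i j,
      edgeInd s(i, j) (ω k) * (edgeInd t.2 (ω t.1.1) * edgeInd t.2 (ω t.1.2)) := by
  have hpow : ∀ a b : ℕ, 0 ≤ z ^ a * w ^ b ∧ z ^ a * w ^ b ≤ 1 := fun a b =>
    unitInterval.mul_mem (Set.mem_Icc.2 ⟨pow_nonneg hz.1 a, pow_le_one₀ hz.1 hz.2⟩)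
      (Set.mem_Icc.2 ⟨pow_nonneg hw.1 b, pow_le_one₀ hw.1 hw.2⟩)
  have hS0 : 0 ≤ ∑ k, edgeInd s(i, j) (ω k) := Finset.sum_nonneg fun k _ => edgeInd_nonneg _ _
  have hR0 : ∀ t ∈ layerOverlaps m i j, 0 ≤ edgeInd t.2 (ω t.1.1) * edgeInd t.2 (ω t.1.2) :=
    fun t _ => mul_nonneg (edgeInd_nonneg _ _) (edgeInd_nonneg _ _)
  rw [← Finset.sum_mul, ← Finset.sum_mul_sum]
  by_cases h : ∃ t ∈ layerOverlaps m i j,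
      t.2 ∈ layerEdges (ω t.1.1) ∧ t.2 ∈ layerEdges (ω t.1.2)
  · obtain ⟨t, ht, h1, h2⟩ := h
    have hR : 1 ≤ ∑ t ∈ layerOverlaps m i j, edgeInd t.2 (ω t.1.1) * edgeInd t.2 (ω t.1.2) := by
      refine le_trans ?_ (Finset.single_le_sum hR0 ht)
      simp [edgeInd, h1, h2]
    have hS : (if s(i, j) ∈ graphEdges ω then (1 : ℝ) else 0) ≤ ∑ k, edgeInd s(i, j) (ω k) := by
      split_ifs with hm
      · obtain ⟨k, hk⟩ := mem_graphEdges.1 hm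
        refine le_trans ?_ (Finset.single_le_sum (f := fun k => edgeInd s(i, j) (ω k))
          (fun k _ => edgeInd_nonneg _ _) (Finset.mem_univ k))
        simp [edgeInd, hk]
      · exact hS0
    have hprod : 0 ≤ ∏ l, (z ^ layerDeg (ω l) i * w ^ layerDeg (ω l) j) ∧
        ∏ l, (z ^ layerDeg (ω l) i * w ^ layerDeg (ω l) j) ≤ 1 :=
      ⟨Finset.prod_nonneg fun l _ => (hpow _ _).1,
        Finset.prod_le_one (fun l _ => (hpow _ _).1) fun l _ => (hpow _ _).2⟩
    have hI : 0 ≤ (if s(i, j) ∈ graphEdges ω then (1 : ℝ) else 0) := by split_ifs <;> norm_num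
    refine le_trans (abs_sub_le_of_nonneg_of_le (mul_nonneg hI (hpow _ _).1)
      ((mul_le_of_le_one_right hI (hpow _ _).2).trans hS) (mul_nonneg hS0 hprod.1)
      (mul_le_of_le_one_right hS0 hprod.2)) (le_mul_of_one_le_right hS0 hR)
  · have hdis : ∀ k l, k ≠ l → ∀ e, (i ∈ e ∨ j ∈ e) → e ∈ layerEdges (ω k) →
        e ∉ layerEdges (ω l) := fun k l hkl e he hk hl =>
      h ⟨((k, l), e), by
        simp [layerOverlaps, mem_incidentPairs, hkl, he, not_isDiag_of_mem_layerEdges hk], hk, hl⟩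
    have hdi := graphDeg_eq_sum (ω := ω) (i := i) fun k l hkl e he => hdis k l hkl e (Or.inl he)
    have hdj := graphDeg_eq_sum (ω := ω) (i := j) fun k l hkl e he => hdis k l hkl e (Or.inr he)
    have hS : (if s(i, j) ∈ graphEdges ω then (1 : ℝ) else 0) = ∑ k, edgeInd s(i, j) (ω k) := by
      split_ifs with hm
      · obtain ⟨k, hk⟩ := mem_graphEdges.1 hm
        rw [Finset.sum_eq_single k]
        · simp [edgeInd, hk]
        · intro l _ hl
          rw [edgeInd, if_neg (hdis k l hl.symm _ (Or.inl (by simp)) hk)]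
        · simp
      · refine (Finset.sum_eq_zero fun k _ => ?_).symm
        rw [edgeInd, if_neg fun hk => hm (mem_graphEdges.2 ⟨k, hk⟩)]
    rw [hS, hdi, hdj, Finset.prod_mul_distrib, Finset.prod_pow_eq_pow_sum,
      Finset.prod_pow_eq_pow_sum, sub_self, abs_zero]
    exact mul_nonneg hS0 (Finset.sum_nonneg hR0)

theorem card_filter_mem_le {A : Finset (Sym2 (Fin n))} {V : Finset (Fin n)}
    (h : ∀ e ∈ A, ∀ v ∈ e, v ∈ V) (i : Fin n) : (A.filter (i ∈ ·)).card ≤ V.card := by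
  have hsub : A.filter (i ∈ ·) ⊆ V.image fun v => s(i, v) := fun e he => by
    rw [Finset.mem_filter] at he
    obtain ⟨v, rfl⟩ := Sym2.mem_iff_exists.1 he.2
    exact Finset.mem_image.2 ⟨v, h _ he.1 v (by simp), rfl⟩
  exact (Finset.card_le_card hsub).trans Finset.card_image_le

theorem card_incidentPairs_le (i j : Fin n) : (incidentPairs i j).card ≤ 2 * n := by
  have hsub : incidentPairs i j ⊆ Finset.univ.filter (i ∈ ·) ∪ Finset.univ.filter (j ∈ ·) :=
    fun e he => by simpa using (mem_incidentPairs.1 he).2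
  have h : ∀ i : Fin n, (Finset.univ.filter fun e : Sym2 (Fin n) => i ∈ e).card ≤ n := fun i => by
    simpa using card_filter_mem_le (A := Finset.univ) (V := Finset.univ) (by simp) i
  have := Finset.card_le_card hsub
  have := Finset.card_union_le (Finset.univ.filter fun e : Sym2 (Fin n) => i ∈ e)
    (Finset.univ.filter fun e : Sym2 (Fin n) => j ∈ e)
  have := h i
  have := h j
  omega

theorem sum_edgeInd_incidentPairs_le (i j : Fin n) (L : Layer n) :
    ∑ e ∈ incidentPairs i j, edgeInd e L ≤ 2 * (L.2.1.card : ℝ) := by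
  have hL : ∀ e ∈ layerEdges L, ∀ v ∈ e, v ∈ L.2.1 := fun e he => (mem_layerEdges.1 he).2.2
  have h1 := card_filter_mem_le hL i
  have h2 := card_filter_mem_le hL j
  have hsub : (incidentPairs i j).filter (· ∈ layerEdges L) ⊆
      (layerEdges L).filter (i ∈ ·) ∪ (layerEdges L).filter (j ∈ ·) := fun e he => by
    rw [Finset.mem_filter] at he
    rw [← Finset.filter_or, Finset.mem_filter]
    exact ⟨he.2, (mem_incidentPairs.1 he.1).2⟩
  have h3 := (Finset.card_le_card hsub).trans (Finset.card_union_le _ _)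
  simp only [edgeInd]
  rw [Finset.sum_boole]
  exact_mod_cast (by omega :
    ((incidentPairs i j).filter (· ∈ layerEdges L)).card ≤ 2 * L.2.1.card)

end Pointwise

/-! ### Expectations over the independent layers -/

section Model

variable {n m : ℕ} {Q : Measure (ℕ × ℝ)} [IsProbabilityMeasure Q]

instance : IsProbabilityMeasure (modelMeasure n m Q) := by
  unfold modelMeasure; infer_instance

theorem integrable_layer {f : Layer n → ℝ} (hf : ∀ L, f ((0, 0), L.2) = f L) :
    Integrable f (layerMeasure n Q) := by
  have hm : Measurable (Prod.snd : Layer n → _) := measurable_snd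
  have hi := (Integrable.of_finite (μ := (layerMeasure n Q).map Prod.snd)
    (f := fun V => f ((0, 0), V))).comp_measurable hm
  exact hi.congr (ae_of_all _ hf)

theorem integrable_model {f : (Fin m → Layer n) → ℝ}
    (hf : ∀ ω, f (fun k => ((0, 0), (ω k).2)) = f ω) :
    Integrable f (modelMeasure n m Q) := by
  have hm : Measurable fun (ω : Fin m → Layer n) k => (ω k).2 :=
    measurable_pi_lambda _ fun k => measurable_snd.comp (measurable_pi_apply k)
  have hi := (Integrable.of_finite (μ := (modelMeasure n m Q).map fun ω k => (ω k).2)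
    (f := fun V => f fun k => ((0, 0), V k))).comp_measurable hm
  exact hi.congr (ae_of_all _ hf)

theorem integral_prod_layers (F : Fin m → Layer n → ℝ) :
    ∫ ω, ∏ k, F k (ω k) ∂modelMeasure n m Q = ∏ k, ∫ L, F k L ∂layerMeasure n Q :=
  integral_fintype_prod_eq_prod F

theorem integral_mul_prod_layers (k : Fin m) (A H : Layer n → ℝ) :
    ∫ ω, A (ω k) * ∏ l, H (ω l) ∂modelMeasure n m Q =
      (∫ L, A L * H L ∂layerMeasure n Q) * (∫ L, H L ∂layerMeasure n Q) ^ (m - 1) := by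
  have h := integral_prod_layers (Q := Q) fun l L => (if l = k then A L else 1) * H L
  simp only [Finset.prod_mul_distrib, Finset.prod_ite_eq', Finset.mem_univ, if_true] at h
  rw [h, ← Finset.mul_prod_erase _ _ (Finset.mem_univ k)]
  congr 1
  · simp
  · have hl : ∀ l ∈ Finset.univ.erase k, ∫ L, (if l = k then A L else 1) * H L ∂layerMeasure n Q =
        ∫ L, H L ∂layerMeasure n Q := fun l hl => by simp [(Finset.mem_erase.1 hl).1]
    rw [Finset.prod_congr rfl hl]
    simp

theorem integral_mul_two_layers {k l : Fin m} (hkl : k ≠ l) (A B : Layer n → ℝ) :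
    ∫ ω, A (ω k) * B (ω l) ∂modelMeasure n m Q =
      (∫ L, A L ∂layerMeasure n Q) * ∫ L, B L ∂layerMeasure n Q := by
  have h := integral_prod_layers (Q := Q) fun r L =>
    (if r = k then A L else 1) * if r = l then B L else 1
  simp only [Finset.prod_mul_distrib, Finset.prod_ite_eq', Finset.mem_univ, if_true] at h
  have hF : ∀ r, ∫ L, (if r = k then A L else 1) * (if r = l then B L else 1) ∂layerMeasure n Q =
      (if r = k then ∫ L, A L ∂layerMeasure n Q else 1) *
        if r = l then ∫ L, B L ∂layerMeasure n Q else 1 := fun r => by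
    by_cases h1 : r = k
    · simp [h1, hkl]
    · by_cases h2 : r = l <;> simp [h1, h2, hkl.symm]
  rw [h]
  simp only [hF, Finset.prod_mul_distrib, Finset.prod_ite_eq', Finset.mem_univ, if_true]

theorem integral_mul_three_layers {k l r : Fin m} (hkl : k ≠ l) (hkr : k ≠ r) (hlr : l ≠ r)
    (A B C : Layer n → ℝ) :
    ∫ ω, A (ω k) * (B (ω l) * C (ω r)) ∂modelMeasure n m Q =
      (∫ L, A L ∂layerMeasure n Q) *
        ((∫ L, B L ∂layerMeasure n Q) * ∫ L, C L ∂layerMeasure n Q) := by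
  have h := integral_prod_layers (Q := Q) fun s L =>
    (if s = k then A L else 1) * ((if s = l then B L else 1) * if s = r then C L else 1)
  simp only [Finset.prod_mul_distrib, Finset.prod_ite_eq', Finset.mem_univ, if_true] at h
  have hF : ∀ s, ∫ L, (if s = k then A L else 1) *
        ((if s = l then B L else 1) * if s = r then C L else 1) ∂layerMeasure n Q =
      (if s = k then ∫ L, A L ∂layerMeasure n Q else 1) *
        ((if s = l then ∫ L, B L ∂layerMeasure n Q else 1) *
        if s = r then ∫ L, C L ∂layerMeasure n Q else 1) := fun s => by
    by_cases h1 : s = k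
    · simp [h1, hkl, hkr]
    · by_cases h2 : s = l
      · simp [h2, hkl.symm, hlr]
      · by_cases h3 : s = r <;> simp [h1, h2, h3, hkr.symm, hlr.symm]
  rw [h]
  simp only [hF, Finset.prod_mul_distrib, Finset.prod_ite_eq', Finset.mem_univ, if_true]

/-- The probability that a given node pair is linked in a layer. -/
def layerAdjProb (n : ℕ) (Q : Measure (ℕ × ℝ)) : ℝ := mom Q 2 1 / n.descFactorial 2

/-- The size-biased probability that a given node pair is linked in a layer. -/
def layerAdjSize (n : ℕ) (Q : Measure (ℕ × ℝ)) : ℝ :=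
  (∫ p, (p.1 : ℝ) * ((p.1.descFactorial 2 : ℝ) * p.2) ∂Q) / n.descFactorial 2

theorem integral_edgeInd_mul_card (hQ : ∀ᵐ p ∂Q, p.1 ≤ n ∧ p.2 ∈ Set.Icc (0 : ℝ) 1)
    {i j : Fin n} (hij : i ≠ j) :
    ∫ L, edgeInd s(i, j) L * (L.2.1.card : ℝ) ∂layerMeasure n Q = layerAdjSize n Q := by
  have h := integral_layer_adj hQ hij (fun k => (k : ℝ)) 1 1
  simp only [one_pow, mul_one, bernPgf_one] at h
  rw [layerAdjSize, ← one_div_mul_eq_div, ← h]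
  simp only [edgeInd, mul_comm]

theorem integral_edgeInd (hQ : ∀ᵐ p ∂Q, p.1 ≤ n ∧ p.2 ∈ Set.Icc (0 : ℝ) 1)
    {e : Sym2 (Fin n)} (he : ¬ e.IsDiag) :
    ∫ L, edgeInd e L ∂layerMeasure n Q = layerAdjProb n Q := by
  induction e using Sym2.ind with
  | _ i j =>
    have hij : i ≠ j := by simpa using he
    have h := integral_layer_adj hQ hij (fun _ => 1) 1 1
    simp only [one_pow, mul_one, one_mul, bernPgf_one] at h
    rw [layerAdjProb, mom_two_one, ← one_div_mul_eq_div, ← h]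
    rfl

omit [IsProbabilityMeasure Q] in
theorem layerAdjProb_nonneg (hQ : ∀ᵐ p ∂Q, p.1 ≤ n ∧ p.2 ∈ Set.Icc (0 : ℝ) 1) :
    0 ≤ layerAdjProb n Q := by
  refine div_nonneg ?_ (Nat.cast_nonneg _)
  rw [mom_two_one]
  exact integral_nonneg_of_ae (hQ.mono fun p hp => mul_nonneg (Nat.cast_nonneg _) hp.2.1)

theorem integral_overlap_le (hQ : ∀ᵐ p ∂Q, p.1 ≤ n ∧ p.2 ∈ Set.Icc (0 : ℝ) 1)
    {e₀ e : Sym2 (Fin n)} (he₀ : ¬ e₀.IsDiag) (he : ¬ e.IsDiag) {k p q : Fin m} (hpq : p ≠ q) :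
    ∫ ω, edgeInd e₀ (ω k) * (edgeInd e (ω p) * edgeInd e (ω q)) ∂modelMeasure n m Q ≤
      layerAdjProb n Q ^ 3 + ((if p = k then 1 else 0) + (if q = k then 1 else 0)) *
        (layerAdjProb n Q * ∫ L, edgeInd e₀ L * edgeInd e L ∂layerMeasure n Q) := by
  have h0 := layerAdjProb_nonneg hQ
  have h3 : 0 ≤ layerAdjProb n Q ^ 3 := by positivity
  by_cases hp : p = k
  · subst hp
    have h := integral_mul_two_layers (Q := Q) hpq (fun L => edgeInd e₀ L * edgeInd e L)
      (edgeInd e)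
    simp only [mul_assoc] at h
    rw [h, integral_edgeInd hQ he, if_pos rfl, if_neg hpq.symm]
    linarith
  · by_cases hq : q = k
    · subst hq
      have h := integral_mul_two_layers (Q := Q) hpq.symm (fun L => edgeInd e₀ L * edgeInd e L)
        (edgeInd e)
      have e1 : ∀ ω : Fin m → Layer n, edgeInd e₀ (ω q) * (edgeInd e (ω p) * edgeInd e (ω q)) =
        edgeInd e₀ (ω q) * edgeInd e (ω q) * edgeInd e (ω p) := fun ω => by ring
      simp only [e1]
      simp only [h, integral_edgeInd hQ he, hpq, if_true, if_false]
      linarith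
    · rw [integral_mul_three_layers (Ne.symm hp) (Ne.symm hq) hpq, integral_edgeInd hQ he₀,
        integral_edgeInd hQ he, if_neg hp, if_neg hq]
      apply le_of_eq
      ring

theorem sum_integral_edgeInd_le (hQ : ∀ᵐ p ∂Q, p.1 ≤ n ∧ p.2 ∈ Set.Icc (0 : ℝ) 1)
    {i j : Fin n} (hij : i ≠ j) :
    ∑ e ∈ incidentPairs i j, ∫ L, edgeInd s(i, j) L * edgeInd e L ∂layerMeasure n Q ≤
      2 * layerAdjSize n Q := by
  rw [← integral_finsetSum _ fun e _ => integrable_layer fun _ => rfl,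
    ← integral_edgeInd_mul_card hQ hij, ← integral_const_mul]
  refine integral_mono (integrable_layer fun _ => rfl) (integrable_layer fun _ => rfl)
    fun L => ?_
  dsimp only
  rw [← Finset.mul_sum]
  nlinarith [mul_le_mul_of_nonneg_left (sum_edgeInd_incidentPairs_le i j L)
    (edgeInd_nonneg s(i, j) L)]

theorem sum_integral_overlap_le (hQ : ∀ᵐ p ∂Q, p.1 ≤ n ∧ p.2 ∈ Set.Icc (0 : ℝ) 1)
    {i j : Fin n} (hij : i ≠ j) :
    ∑ k : Fin m, ∑ t ∈ layerOverlaps m i j, ∫ ω, edgeInd s(i, j) (ω k) *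
        (edgeInd t.2 (ω t.1.1) * edgeInd t.2 (ω t.1.2)) ∂modelMeasure n m Q ≤
      2 * n * m ^ 3 * layerAdjProb n Q ^ 3 +
        4 * m ^ 2 * (layerAdjProb n Q * layerAdjSize n Q) := by
  have h0 := layerAdjProb_nonneg hQ
  have hq : ∀ e, 0 ≤ ∫ L, edgeInd s(i, j) L * edgeInd e L ∂layerMeasure n Q := fun e =>
    integral_nonneg fun L => mul_nonneg (edgeInd_nonneg _ _) (edgeInd_nonneg _ _)
  have hs := sum_integral_edgeInd_le hQ hij
  have he₀ : ¬ (s(i, j)).IsDiag := by simpa using hij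
  calc _ ≤ ∑ k : Fin m, ∑ t ∈ (Finset.univ : Finset (Fin m × Fin m)) ×ˢ incidentPairs i j,
        (layerAdjProb n Q ^ 3 +
        ((if t.1.1 = k then 1 else 0) + (if t.1.2 = k then 1 else 0)) *
        (layerAdjProb n Q * ∫ L, edgeInd s(i, j) L * edgeInd t.2 L ∂layerMeasure n Q)) := by
        refine Finset.sum_le_sum fun k _ => ?_
        refine (Finset.sum_le_sum fun t ht => ?_).trans
          (Finset.sum_le_sum_of_subset_of_nonneg (Finset.filter_subset _ _) fun t _ _ => ?_)
        · rw [layerOverlaps, Finset.mem_filter, Finset.mem_product] at ht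
          exact integral_overlap_le hQ he₀ (mem_incidentPairs.1 ht.1.2).1 ht.2
        · have := hq t.2
          positivity
    _ = m ^ 3 * (incidentPairs i j).card * layerAdjProb n Q ^ 3 +
        2 * m ^ 2 * (layerAdjProb n Q *
          ∑ e ∈ incidentPairs i j, ∫ L, edgeInd s(i, j) L * edgeInd e L ∂layerMeasure n Q) := by
        have hk : ∀ k : Fin m, ∑ t : Fin m × Fin m,
            ((if t.1 = k then (1 : ℝ) else 0) + (if t.2 = k then 1 else 0)) = 2 * m := fun k => by
          have h1 : ∀ x : Fin m, ((if x = k then Finset.univ else ∅ : Finset (Fin m)).card : ℝ) =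
            if x = k then (m : ℝ) else 0 := fun x => by split_ifs <;> simp
          rw [Fintype.sum_prod_type]
          simp [Finset.sum_add_distrib, h1]
          ring
        have hi : ∀ k : Fin m, ∑ t ∈ (Finset.univ : Finset (Fin m × Fin m)) ×ˢ incidentPairs i j,
            ((if t.1.1 = k then 1 else 0) + (if t.1.2 = k then 1 else 0)) *
            (layerAdjProb n Q * ∫ L, edgeInd s(i, j) L * edgeInd t.2 L ∂layerMeasure n Q) =
            2 * m * (layerAdjProb n Q * ∑ e ∈ incidentPairs i j,
              ∫ L, edgeInd s(i, j) L * edgeInd e L ∂layerMeasure n Q) := fun k => by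
          rw [← hk k, Finset.mul_sum, Finset.sum_mul_sum, Finset.sum_product]
        simp only [Finset.sum_add_distrib, hi]
        simp
        ring
    _ ≤ m ^ 3 * ((2 * n : ℕ) : ℝ) * layerAdjProb n Q ^ 3 +
        2 * m ^ 2 * (layerAdjProb n Q * (2 * layerAdjSize n Q)) := by
        gcongr
        exact card_incidentPairs_le i j
    _ = _ := by push_cast; ring

end Model

/-! ### The bidegree generating function of adjacent nodes -/

theorem abs_integral_pgf_sub_le {n m : ℕ} {Q : Measure (ℕ × ℝ)} [IsProbabilityMeasure Q]
    (hQ : ∀ᵐ p ∂Q, p.1 ≤ n ∧ p.2 ∈ Set.Icc (0 : ℝ) 1) {i j : Fin n} (hij : i ≠ j) {z w : ℝ}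
    (hz : z ∈ Set.Icc (0 : ℝ) 1) (hw : w ∈ Set.Icc (0 : ℝ) 1) :
    |∫ ω, (if s(i, j) ∈ graphEdges ω then 1 else 0) * (z ^ graphDeg ω i * w ^ graphDeg ω j)
        ∂modelMeasure n m Q -
      m * ((z * w / n.descFactorial 2 * ∫ p, (p.1.descFactorial 2 : ℝ) * p.2 *
        (bernPgf p.2 z ^ (p.1 - 2) * bernPgf p.2 w ^ (p.1 - 2)) ∂Q) *
        layerPgf n Q z w ^ (m - 1))| ≤
      2 * n * m ^ 3 * layerAdjProb n Q ^ 3 +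
        4 * m ^ 2 * (layerAdjProb n Q * layerAdjSize n Q) := by
  have hk : ∀ k : Fin m, ∫ ω, edgeInd s(i, j) (ω k) *
      ∏ l, (z ^ layerDeg (ω l) i * w ^ layerDeg (ω l) j) ∂modelMeasure n m Q =
      (z * w / n.descFactorial 2 * ∫ p, (p.1.descFactorial 2 : ℝ) * p.2 *
        (bernPgf p.2 z ^ (p.1 - 2) * bernPgf p.2 w ^ (p.1 - 2)) ∂Q) *
        layerPgf n Q z w ^ (m - 1) := fun k => by
    have h := integral_layer_adj hQ hij (fun _ => 1) z w
    simp only [one_mul] at h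
    rw [integral_mul_prod_layers k (edgeInd s(i, j))
      (fun L => z ^ layerDeg L i * w ^ layerDeg L j), integral_pow_layerDeg hQ hij, ← h]
    rfl
  have hsum : ∫ ω, ∑ k : Fin m, edgeInd s(i, j) (ω k) *
      ∏ l, (z ^ layerDeg (ω l) i * w ^ layerDeg (ω l) j) ∂modelMeasure n m Q =
      m * ((z * w / n.descFactorial 2 * ∫ p, (p.1.descFactorial 2 : ℝ) * p.2 *
        (bernPgf p.2 z ^ (p.1 - 2) * bernPgf p.2 w ^ (p.1 - 2)) ∂Q) *
        layerPgf n Q z w ^ (m - 1)) := by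
    rw [integral_finsetSum _ fun k _ => integrable_model fun _ => rfl,
      Finset.sum_congr rfl fun k _ => hk k]
    simp
  rw [← hsum, ← integral_sub (integrable_model fun _ => rfl) (integrable_model fun _ => rfl)]
  refine le_trans abs_integral_le_integral_abs
    (le_trans (integral_mono (integrable_model fun _ => rfl) (integrable_model fun _ => rfl)
      fun ω => abs_pgf_sub_le hz hw ω) ?_)
  rw [integral_finsetSum _ fun k _ => integrable_model fun _ => rfl,
    Finset.sum_congr rfl fun k _ => integral_finsetSum _ fun t _ => integrable_model fun _ => rfl]
  exact sum_integral_overlap_le hQ hij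

/-- The joint degree generating function of the first two nodes on the event that they are
adjacent. -/
def adjPgf (n m : ℕ) (Q : Measure (ℕ × ℝ)) [IsProbabilityMeasure Q] (z w : ℝ) : ℝ :=
  ∫ ω in adjEvent n m, z ^ deg ω 0 * w ^ deg ω 1 ∂modelMeasure n m Q

theorem deg_eq_graphDeg {n m : ℕ} (ω : Fin m → Layer n) (i : Fin n) :
    deg ω i = graphDeg ω i := by
  unfold deg graphDeg
  congr 1
  refine Finset.filter_congr fun e _ => ⟨?_, fun h => ⟨i, h, rfl⟩⟩
  rintro ⟨v, hv, hvi⟩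
  rwa [← Fin.ext hvi]

theorem mem_adjEvent {n m : ℕ} (hn : 2 ≤ n) {ω : Fin m → Layer n} :
    ω ∈ adjEvent n m ↔ s((⟨0, by omega⟩ : Fin n), ⟨1, by omega⟩) ∈ graphEdges ω := by
  unfold adjEvent
  rw [Set.mem_ofPred_eq]
  constructor
  · rintro ⟨e, he, ⟨u, hu, hu0⟩, v, hv, hv1⟩
    have huv : u ≠ v := fun h => by rw [h] at hu0; omega
    rw [(Sym2.mem_and_mem_iff huv).1 ⟨hu, hv⟩] at he
    rwa [show (⟨0, by omega⟩ : Fin n) = u from Fin.ext hu0.symm,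
      show (⟨1, by omega⟩ : Fin n) = v from Fin.ext hv1.symm]
  · intro h
    exact ⟨_, h, ⟨⟨0, by omega⟩, by simp, rfl⟩, ⟨1, by omega⟩, by simp, rfl⟩

theorem measurableSet_model {n m : ℕ} {s : Set (Fin m → Layer n)}
    (hs : ∀ ω, (fun k => ((0, 0), (ω k).2)) ∈ s ↔ ω ∈ s) : MeasurableSet s := by
  have hm : Measurable fun (ω : Fin m → Layer n) k => (ω k).2 :=
    measurable_pi_lambda _ fun k => measurable_snd.comp (measurable_pi_apply k)
  convert hm (MeasurableSet.of_discrete (s := {V | (fun k => ((0, 0), V k)) ∈ s})) using 1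
  ext ω
  exact (hs ω).symm

theorem measurableSet_adjEvent (n m : ℕ) : MeasurableSet (adjEvent n m) :=
  measurableSet_model fun _ => Iff.rfl

theorem adjPgf_eq {n m : ℕ} (hn : 2 ≤ n) (Q : Measure (ℕ × ℝ)) [IsProbabilityMeasure Q]
    (z w : ℝ) : adjPgf n m Q z w =
      ∫ ω, (if s((⟨0, by omega⟩ : Fin n), ⟨1, by omega⟩) ∈ graphEdges ω then 1 else 0) *
        (z ^ graphDeg ω (⟨0, by omega⟩ : Fin n) * w ^ graphDeg ω (⟨1, by omega⟩ : Fin n))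
        ∂modelMeasure n m Q := by
  rw [adjPgf, ← integral_indicator (measurableSet_adjEvent n m)]
  congr 1 with ω
  rw [Set.indicator_apply, if_congr (mem_adjEvent hn) rfl rfl, ite_mul, one_mul, zero_mul,
    ← deg_eq_graphDeg, ← deg_eq_graphDeg]

section AdjAsymptotics

variable {Pn : ℕ → ProbabilityMeasure (ℕ × ℝ)} {P : ProbabilityMeasure (ℕ × ℝ)} {z w mu : ℝ}
  {m : ℕ → ℕ}

theorem tendsto_overlap_bound (hweak : Tendsto Pn atTop (𝓝 P))
    (hPn : ∀ n, ∀ᵐ p ∂(Pn n : Measure (ℕ × ℝ)), p.1 ≤ n ∧ p.2 ∈ Set.Icc (0 : ℝ) 1)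
    (hP : ∀ᵐ p ∂(P : Measure (ℕ × ℝ)), p.2 ∈ Set.Icc (0 : ℝ) 1)
    (hratio : Tendsto (fun n : ℕ => (m n : ℝ) / n) atTop (𝓝 mu))
    (hint21 : Integrable (fun p : ℕ × ℝ => (p.1.descFactorial 2 : ℝ) * p.2)
      (P : Measure (ℕ × ℝ)))
    (h21 : Tendsto (fun n : ℕ => mom (Pn n : Measure (ℕ × ℝ)) 2 1) atTop
      (𝓝 (mom (P : Measure (ℕ × ℝ)) 2 1))) :
    Tendsto (fun n : ℕ => (n : ℝ) *
      (2 * n * m n ^ 3 * layerAdjProb n (Pn n : Measure (ℕ × ℝ)) ^ 3 +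
        4 * m n ^ 2 * (layerAdjProb n (Pn n : Measure (ℕ × ℝ)) *
          layerAdjSize n (Pn n : Measure (ℕ × ℝ))))) atTop (𝓝 0) := by
  have hr := tendsto_mul_div_descFactorial hratio
  have hb := tendsto_adj_remainder hweak hPn hP hint21 h21
  have h := (((hr.pow 3).mul (h21.pow 3)).mul (tendsto_const_div_atTop_nhds_zero_nat (2 : ℝ))).add
    (((hr.pow 2).mul h21).mul (hb.const_mul 4))
  simp only [mul_zero, add_zero] at h
  refine h.congr' (eventually_atTop.2 ⟨1, fun n hn => ?_⟩)
  have hn0 : (n : ℝ) ≠ 0 := by positivity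
  dsimp only
  rw [layerAdjProb, layerAdjSize]
  field_simp

theorem tendsto_adjPgf (hweak : Tendsto Pn atTop (𝓝 P))
    (hPn : ∀ n, ∀ᵐ p ∂(Pn n : Measure (ℕ × ℝ)), p.1 ≤ n ∧ p.2 ∈ Set.Icc (0 : ℝ) 1)
    (hP : ∀ᵐ p ∂(P : Measure (ℕ × ℝ)), p.2 ∈ Set.Icc (0 : ℝ) 1)
    (hratio : Tendsto (fun n : ℕ => (m n : ℝ) / n) atTop (𝓝 mu))
    (hint10 : Integrable (fun p : ℕ × ℝ => (p.1 : ℝ)) (P : Measure (ℕ × ℝ)))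
    (hint21 : Integrable (fun p : ℕ × ℝ => (p.1.descFactorial 2 : ℝ) * p.2)
      (P : Measure (ℕ × ℝ)))
    (h10pos : 0 < mom (P : Measure (ℕ × ℝ)) 1 0)
    (h21pos : 0 < mom (P : Measure (ℕ × ℝ)) 2 1)
    (h10 : Tendsto (fun n : ℕ => mom (Pn n : Measure (ℕ × ℝ)) 1 0) atTop
      (𝓝 (mom (P : Measure (ℕ × ℝ)) 1 0)))
    (h21 : Tendsto (fun n : ℕ => mom (Pn n : Measure (ℕ × ℝ)) 2 1) atTop
      (𝓝 (mom (P : Measure (ℕ × ℝ)) 2 1)))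
    (hz : z ∈ Set.Icc (0 : ℝ) 1) (hw : w ∈ Set.Icc (0 : ℝ) 1) :
    Tendsto (fun n : ℕ => (n : ℝ) * adjPgf n (m n) (Pn n : Measure (ℕ × ℝ)) z w) atTop
      (𝓝 (mu * mom (P : Measure (ℕ × ℝ)) 2 1 * barPgf mu (P : Measure (ℕ × ℝ)) z w)) := by
  have hpow := tendsto_pow_of_tendsto_mul_sub_one
    (a := fun n => layerPgf n (Pn n : Measure (ℕ × ℝ)) z w)
    (eventually_atTop.2 ⟨2, fun n hn => layerPgf_nonneg hn (hPn n) hz.1 hw.1⟩)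
    (tendsto_layerPgf hweak hPn hP hint10 h10pos h10 hz hw) (tendsto_sub_one_div hratio)
  have hmain := (((tendsto_mul_div_descFactorial hratio).const_mul (z * w)).mul
    (tendsto_adj_term hweak hPn hP hint21 h21pos h21 hz hw)).mul hpow
  have hdiff : Tendsto (fun n : ℕ => (n : ℝ) * adjPgf n (m n) (Pn n : Measure (ℕ × ℝ)) z w -
      z * w * ((n : ℝ) * m n / n.descFactorial 2) *
      (∫ p, (p.1.descFactorial 2 : ℝ) * p.2 * (bernPgf p.2 z ^ (p.1 - 2) *
        bernPgf p.2 w ^ (p.1 - 2)) ∂(Pn n : Measure (ℕ × ℝ))) *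
      layerPgf n (Pn n : Measure (ℕ × ℝ)) z w ^ (m n - 1)) atTop (𝓝 0) := by
    refine squeeze_zero_norm' (eventually_atTop.2 ⟨2, fun n hn => ?_⟩)
      (tendsto_overlap_bound hweak hPn hP hratio hint21 h21)
    have hij : (⟨0, by omega⟩ : Fin n) ≠ ⟨1, by omega⟩ := by simp
    rw [adjPgf_eq hn, Real.norm_eq_abs]
    refine le_trans (le_of_eq ?_) (mul_le_mul_of_nonneg_left
      (abs_integral_pgf_sub_le (m := m n) (hPn n) hij hz hw) (Nat.cast_nonneg n))
    rw [← abs_of_nonneg (Nat.cast_nonneg n : (0 : ℝ) ≤ n), ← abs_mul,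
      abs_of_nonneg (Nat.cast_nonneg n : (0 : ℝ) ≤ n)]
    congr 1
    ring
  have h := hdiff.add hmain
  simp only [sub_add_cancel, zero_add] at h
  convert h using 2
  rw [barPgf, ← Real.exp_add]
  ring_nf

end AdjAsymptotics

/-! ### Convergence of the model bidegree distribution -/

section Bidegree

variable {n m : ℕ} {Q : Measure (ℕ × ℝ)} [IsProbabilityMeasure Q]

theorem adjPgf_one : adjPgf n m Q 1 1 = (modelMeasure n m Q).real (adjEvent n m) := by
  simp [adjPgf]

theorem measurable_bideg : Measurable fun ω : Fin m → Layer n => (deg ω 0, deg ω 1) :=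
  measurable_to_countable' fun _ => measurableSet_model fun _ => Iff.rfl

theorem bidegree_eq (s t : ℕ) : bidegree n m Q s t =
    (((modelMeasure n m Q)[|adjEvent n m]).map fun ω => (deg ω 0, deg ω 1)).real {(s, t)} := by
  rw [Measure.real, Measure.map_apply measurable_bideg (measurableSet_singleton _), bidegree]
  congr 2
  ext ω
  simp

theorem bidegree_mem_Icc (s t : ℕ) : bidegree n m Q s t ∈ Set.Icc (0 : ℝ) 1 := by
  rw [bidegree_eq]
  refine ⟨measureReal_nonneg, ?_⟩
  rw [Measure.real, Measure.map_apply measurable_bideg (measurableSet_singleton _)]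
  exact ENNReal.toReal_le_of_le_ofReal zero_le_one (by
    simpa using prob_le_one)

theorem tsum_bidegree_mul_pow {z w : ℝ} (hz : z ∈ Set.Icc (0 : ℝ) 1)
    (hw : w ∈ Set.Icc (0 : ℝ) 1) :
    ∑' u : ℕ × ℕ, bidegree n m Q u.1 u.2 * (z ^ u.1 * w ^ u.2) =
      adjPgf n m Q z w / adjPgf n m Q 1 1 := by
  have hi : Integrable (fun u : ℕ × ℕ => z ^ u.1 * w ^ u.2)
      (((modelMeasure n m Q)[|adjEvent n m]).map fun ω => (deg ω 0, deg ω 1)) := by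
    refine Integrable.of_bound (Measurable.of_discrete).aestronglyMeasurable 1
      (ae_of_all _ fun u => ?_)
    rw [Real.norm_of_nonneg (mul_nonneg (pow_nonneg hz.1 _) (pow_nonneg hw.1 _))]
    exact mul_le_one₀ (pow_le_one₀ hz.1 hz.2) (pow_nonneg hw.1 _) (pow_le_one₀ hw.1 hw.2)
  have h := integral_countable hi
  rw [integral_map measurable_bideg.aemeasurable (Measurable.of_discrete).aestronglyMeasurable,
    ProbabilityTheory.cond, integral_smul_measure] at h
  simp only [bidegree_eq]
  simp only [smul_eq_mul] at h
  rw [adjPgf_one, div_eq_inv_mul, Measure.real, ← ENNReal.toReal_inv]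
  exact h.symm

theorem hasSum_bidegree (h : adjPgf n m Q 1 1 ≠ 0) :
    HasSum (fun u : ℕ × ℕ => bidegree n m Q u.1 u.2) 1 := by
  have h1 := tsum_bidegree_mul_pow (n := n) (m := m) (Q := Q) (z := 1) (w := 1) (by simp) (by simp)
  simp only [one_pow, mul_one] at h1
  rw [div_self h] at h1
  have hs : Summable fun u : ℕ × ℕ => bidegree n m Q u.1 u.2 := by
    by_contra hs
    rw [tsum_eq_zero_of_not_summable hs] at h1
    exact zero_ne_one h1
  exact h1 ▸ hs.hasSum

end Bidegree

/-- **Theorem 5, Spearman rank correlation** (Bloznelis–Karjalainen–Leskelä).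
If `m/n → μ ∈ (0,∞)`, `P⁽ⁿ⁾ → P` weakly and `P⁽ⁿ⁾_{rs} → P_{rs} ∈ (0,∞)` for
`rs = 10, 21`, then `ρ_Spe(f_{2,n}) → ρ_Spe(\bar f₂)`. -/
theorem spearman_tendsto
    (mu : ℝ) (hmu : 0 < mu)
    (m : ℕ → ℕ) (hm : Tendsto m atTop atTop)
    (hratio : Tendsto (fun n : ℕ => (m n : ℝ) / n) atTop (𝓝 mu))
    (Pn : ℕ → ProbabilityMeasure (ℕ × ℝ)) (P : ProbabilityMeasure (ℕ × ℝ))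
    (hsupp : ∀ n, (Pn n : Measure (ℕ × ℝ)) {p : ℕ × ℝ | p.1 ≤ n ∧ p.2 ∈ Set.Icc (0:ℝ) 1} = 1)
    (hPsupp : (P : Measure (ℕ × ℝ)) {p : ℕ × ℝ | p.2 ∈ Set.Icc (0:ℝ) 1} = 1)
    (hweak : Tendsto Pn atTop (𝓝 P))
    (hint10 : Integrable (fun p : ℕ × ℝ => (p.1.descFactorial 1 : ℝ) * p.2 ^ (0:ℕ))
      (P : Measure (ℕ × ℝ)))
    (hint21 : Integrable (fun p : ℕ × ℝ => (p.1.descFactorial 2 : ℝ) * p.2 ^ (1:ℕ))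
      (P : Measure (ℕ × ℝ)))
    (h10pos : 0 < mom (P : Measure (ℕ × ℝ)) 1 0)
    (h21pos : 0 < mom (P : Measure (ℕ × ℝ)) 2 1)
    (h10 : Tendsto (fun n : ℕ => mom (Pn n : Measure (ℕ × ℝ)) 1 0) atTop
      (𝓝 (mom (P : Measure (ℕ × ℝ)) 1 0)))
    (h21 : Tendsto (fun n : ℕ => mom (Pn n : Measure (ℕ × ℝ)) 2 1) atTop
      (𝓝 (mom (P : Measure (ℕ × ℝ)) 2 1))) :
    Tendsto (fun n : ℕ => spearman (bidegree n (m n) (Pn n : Measure (ℕ × ℝ)))) atTop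
      (𝓝 (spearman (barf2 mu (P : Measure (ℕ × ℝ))))) := by
  have hmeas : MeasurableSet {p : ℕ × ℝ | p.2 ∈ Set.Icc (0 : ℝ) 1} :=
    measurable_snd measurableSet_Icc
  have hPn : ∀ n, ∀ᵐ p ∂(Pn n : Measure (ℕ × ℝ)), p.1 ≤ n ∧ p.2 ∈ Set.Icc (0 : ℝ) 1 := fun n =>
    ae_of_measure_eq_one ((measurableSet_fst_le n).inter hmeas) (hsupp n)
  have hP : ∀ᵐ p ∂(P : Measure (ℕ × ℝ)), p.2 ∈ Set.Icc (0 : ℝ) 1 :=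
    ae_of_measure_eq_one hmeas hPsupp
  simp only [Nat.descFactorial_one, pow_zero, mul_one] at hint10
  simp only [pow_one] at hint21
  have hone : (1 : ℝ) ∈ Set.Icc (0 : ℝ) 1 := by simp
  have hadj : ∀ z ∈ Set.Icc (0 : ℝ) 1, ∀ w ∈ Set.Icc (0 : ℝ) 1,
      Tendsto (fun n : ℕ => (n : ℝ) * adjPgf n (m n) (Pn n : Measure (ℕ × ℝ)) z w) atTop
        (𝓝 (mu * mom (P : Measure (ℕ × ℝ)) 2 1 * barPgf mu (P : Measure (ℕ × ℝ)) z w)) :=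
    fun z hz w hw =>
      tendsto_adjPgf hweak hPn hP hratio hint10 hint21 h10pos h21pos h10 h21 hz hw
  have hlim : 0 < mu * mom (P : Measure (ℕ × ℝ)) 2 1 := mul_pos hmu h21pos
  have hadj1 := hadj 1 hone 1 hone
  rw [barPgf_one h10pos h21pos, mul_one] at hadj1
  have hne : ∀ᶠ n : ℕ in atTop, adjPgf n (m n) (Pn n : Measure (ℕ × ℝ)) 1 1 ≠ 0 :=
    (hadj1.eventually (lt_mem_nhds hlim)).mono fun n hn h => by simp [h] at hn
  have hG0 := fun s t => barf2_nonneg hP h10pos h21pos hmu s t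
  have hG1 : HasSum (fun u : ℕ × ℕ => barf2 mu (P : Measure (ℕ × ℝ)) u.1 u.2) 1 := by
    have h := hasSum_barf2_pgf hP h10pos h21pos hint10 hint21 hmu hone hone
    simpa [barPgf_one h10pos h21pos] using h
  have hmass : ∀ s t, Tendsto (fun n => bidegree n (m n) (Pn n : Measure (ℕ × ℝ)) s t) atTop
      (𝓝 (barf2 mu (P : Measure (ℕ × ℝ)) s t)) := by
    refine tendsto_mass_of_tendsto_pgf (Eventually.of_forall fun n s t => bidegree_mem_Icc s t)
      (fun s t => ⟨hG0 s t, le_hasSum hG1 (s, t) fun u _ => hG0 u.1 u.2⟩) fun z hz w hw => ?_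
    have hz' := Set.Ioo_subset_Icc_self hz
    have hw' := Set.Ioo_subset_Icc_self hw
    rw [(hasSum_barf2_pgf hP h10pos h21pos hint10 hint21 hmu hz' hw').tsum_eq]
    have h := (hadj z hz' w hw').div hadj1 hlim.ne'
    rw [mul_div_cancel_left₀ _ hlim.ne'] at h
    refine h.congr' ((eventually_ge_atTop 1).mono fun n hn => ?_)
    have hn0 : (n : ℝ) ≠ 0 := by positivity
    exact (mul_div_mul_left _ _ hn0).trans (tsum_bidegree_mul_pow hz' hw').symm
  obtain ⟨s, t, k, hk, h1, h2, h3⟩ := exists_barf2_pos hP h10pos h21pos hint10 hint21 hmu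
  exact spearman_continuity (Eventually.of_forall fun n s t => (bidegree_mem_Icc s t).1)
    (hne.mono fun n hn => hasSum_bidegree hn) hG0 hG1 hmass
    ⟨(s, t), (s + k, t), h1, h2, by simpa using hk⟩ ⟨(s, t), (s, t + k), h1, h3, by simpa using hk⟩
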